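/- arXiv:1010.0146 — 5 statements merged into one kernel-verified Lean document; each statement's English description precedes it below -/
import Mathlib

section
/- Let s ≥ 1 and x ≥ 2 be integers and set h = x·s. Then the number of elements of NC^A(h) that are invariant under the rotation ρ_s equals (s+1)·C_s = C(2s, s) (the central binomial coefficient), where C_s is the s-th Catalan number. -/
/-- `NCA m` is the set of noncrossing partitions of `{0, 1, …, m-1}` (modelled as `Fin m`):
set partitions `P` such that there are no `a < b < c < d` with `a, c` in one block and
`b, d` in a different block. -/
def NCA (m : ℕ) : Set (Set (Set (Fin m))) :=
  {P | Setoid.IsPartition P ∧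
    ∀ a b c d : Fin m, a < b → b < c → c < d →
      ∀ B ∈ P, ∀ B' ∈ P, B ≠ B' → a ∈ B → c ∈ B → b ∈ B' → d ∈ B' → False}

/-- The rotation `ρ_t : i ↦ i + t (mod m)`. -/
def rot (m t : ℕ) (i : Fin m) : Fin m := ⟨(i.val + t) % m, Nat.mod_lt _ i.pos⟩

/-- A partition is invariant under `ρ_t` if the image of every block is again a block. -/
def RotInv (m t : ℕ) (P : Set (Set (Fin m))) : Prop := ∀ B ∈ P, rot m t '' B ∈ P


structure GoodF (s : ℤ) (F : ℤ → Option ℤ) : Prop where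
  le : ∀ m l, F m = some l → l ≤ m
  idem : ∀ m l, F m = some l → F l = some l
  shift : ∀ m l, F m = some l → F (m + s) = some (l + s)
  unshift : ∀ m l, F (m + s) = some l → F m = some (l - s)
  nc : ∀ m l n, F m = some l → l ≤ n → n ≤ m → ∃ l', F n = some l' ∧ l ≤ l'

theorem GoodF.lt {s : ℤ} {F : ℤ → Option ℤ} (hF : GoodF s F) (hs : 0 < s) (m l : ℤ)
    (h : F m = some l) : m < l + s := by
  by_contra hc
  obtain ⟨l', h1, h2⟩ := hF.nc (m + s) (l + s) m (hF.shift m l h) (by omega) (by omega)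
  rw [h] at h1
  simp at h1
  omega

theorem GoodF.shift_iff {s : ℤ} {F : ℤ → Option ℤ} (hF : GoodF s F) (m l : ℤ) :
    F (m + s) = some (l + s) ↔ F m = some l := by
  constructor
  · intro h
    have := hF.unshift _ _ h
    simpa using this
  · exact hF.shift m l

theorem GoodF.shift_mul {s : ℤ} {F : ℤ → Option ℤ} (hF : GoodF s F) (k m l : ℤ) :
    F (m + s * k) = some (l + s * k) ↔ F m = some l := by
  induction k using Int.induction_on with
  | zero => simp
  | succ i ih =>
    rw [← ih, ← hF.shift_iff (m + s * i) (l + s * i)]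
    have e1 : m + s * ((i : ℤ) + 1) = m + s * i + s := by ring
    have e2 : l + s * ((i : ℤ) + 1) = l + s * i + s := by ring
    rw [e1, e2]
  | pred i ih =>
    rw [← ih, ← hF.shift_iff (m + s * (-(i : ℤ) - 1)) (l + s * (-(i : ℤ) - 1))]
    have e1 : m + s * (-(i : ℤ) - 1) + s = m + s * (-(i : ℤ)) := by ring
    have e2 : l + s * (-(i : ℤ) - 1) + s = l + s * (-(i : ℤ)) := by ring
    rw [e1, e2]


noncomputable def wt (s : ℤ) (F : ℤ → Option ℤ) (l : ℤ) : ℕ := ((Finset.Ico l (l + s)).filter (fun n => F n = some l)).card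

theorem wt_shift {s : ℤ} {F : ℤ → Option ℤ} (hF : GoodF s F) (k l : ℤ) :
    wt s F (l + s * k) = wt s F l := by
  symm
  unfold wt
  apply Finset.card_bij (fun n _ => n + s * k)
  · intro a ha
    simp only [Finset.mem_filter, Finset.mem_Ico] at ha ⊢
    exact ⟨by omega, (hF.shift_mul _ _ _).2 ha.2⟩
  · intro a _ b _ h
    simpa using h
  · intro b hb
    simp only [Finset.mem_filter, Finset.mem_Ico] at hb
    refine ⟨b - s * k, ?_, by ring⟩
    simp only [Finset.mem_filter, Finset.mem_Ico]
    refine ⟨by omega, ?_⟩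
    rw [← hF.shift_mul k]
    simpa using hb.2

theorem sum_wt {s : ℤ} {F : ℤ → Option ℤ} (hF : GoodF s F) (hs : 0 < s) (i m : ℤ) :
    ∑ l ∈ Finset.Icc i m, wt s F l =
      ((Finset.Ico i (m + s)).filter (fun n => ∃ l, F n = some l ∧ i ≤ l ∧ l ≤ m)).card := by
  classical
  rw [Finset.card_eq_sum_card_fiberwise (f := fun n => (F n).getD 0) (t := Finset.Icc i m)]
  · apply Finset.sum_congr rfl
    intro l hl
    unfold wt
    congr 1
    ext n
    simp only [Finset.mem_filter, Finset.mem_Ico, Finset.mem_Icc] at hl ⊢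
    constructor
    · rintro ⟨h1, h2⟩
      exact ⟨⟨by omega, l, h2, hl⟩, by simp [h2]⟩
    · rintro ⟨⟨h1, l', h2, h3⟩, h4⟩
      simp [h2] at h4
      subst h4
      have := hF.le _ _ h2
      have := hF.lt hs _ _ h2
      exact ⟨by omega, h2⟩
  · intro n hn
    simp only [Finset.coe_filter, Set.mem_ofPred_eq, Finset.coe_Icc, Set.mem_Icc] at hn ⊢
    obtain ⟨_, l, h1, h2⟩ := hn
    simpa [h1] using h2

theorem sum_wt_lt {s : ℤ} {F : ℤ → Option ℤ} (hF : GoodF s F) (hs : 0 < s) (i m : ℤ)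
    (him : i ≤ m) (h : ∀ l, F m = some l → l < i) :
    ((∑ l ∈ Finset.Icc i m, wt s F l : ℕ) : ℤ) < m + 1 - i := by
  rw [sum_wt hF hs]
  have : ((Finset.Ico i (m + s)).filter (fun n => ∃ l, F n = some l ∧ i ≤ l ∧ l ≤ m)) ⊆
      Finset.Ico i m := by
    intro n hn
    simp only [Finset.mem_filter, Finset.mem_Ico] at hn ⊢
    obtain ⟨h0, l, h1, h2, h3⟩ := hn
    refine ⟨h0.1, ?_⟩
    by_contra hc
    obtain ⟨l', h4, h5⟩ := hF.nc n l m h1 h3 (by omega)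
    have := h _ h4
    omega
  have := Finset.card_le_card this
  rw [Int.card_Ico] at this
  omega

theorem sum_wt_ge {s : ℤ} {F : ℤ → Option ℤ} (hF : GoodF s F) (hs : 0 < s) (l m : ℤ)
    (h : F m = some l) :
    m + 1 - l ≤ ((∑ l ∈ Finset.Icc l m, wt s F l : ℕ) : ℤ) := by
  rw [sum_wt hF hs]
  have : Finset.Icc l m ⊆ ((Finset.Ico l (m + s)).filter
      (fun n => ∃ l', F n = some l' ∧ l ≤ l' ∧ l' ≤ m)) := by
    intro n hn
    simp only [Finset.mem_filter, Finset.mem_Ico, Finset.mem_Icc] at hn ⊢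
    obtain ⟨l', h1, h2⟩ := hF.nc m l n h hn.1 hn.2
    have := hF.le _ _ h1
    exact ⟨by omega, l', h1, h2, by omega⟩
  have := Finset.card_le_card this
  rw [Int.card_Icc] at this
  omega

theorem F_of_wt {s : ℤ} {F F' : ℤ → Option ℤ} (hF : GoodF s F) (hF' : GoodF s F') (hs : 0 < s)
    (h : ∀ l, wt s F l = wt s F' l) (m l : ℤ) (hl : F m = some l) : ∃ l', F' m = some l' ∧ l ≤ l' := by
  by_contra hc
  push Not at hc
  have h1 := sum_wt_ge hF hs l m hl
  have h2 := sum_wt_lt hF' hs l m (hF.le _ _ hl) (fun l' h' => hc l' h')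
  simp only [h] at h1
  omega

theorem F_eq_of_wt {s : ℤ} {F F' : ℤ → Option ℤ} (hF : GoodF s F) (hF' : GoodF s F') (hs : 0 < s)
    (h : ∀ l, wt s F l = wt s F' l) : F = F' := by
  funext m
  have h1 := F_of_wt hF hF' hs h m
  have h2 := F_of_wt hF' hF hs (fun l => (h l).symm) m
  cases e : F m with
  | none =>
    cases e' : F' m with
    | none => rfl
    | some l => obtain ⟨l', h3, _⟩ := h2 l e'; simp [e] at h3
  | some l =>
    obtain ⟨l', h3, h4⟩ := h1 l e
    obtain ⟨l'', h5, h6⟩ := h2 l' h3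
    rw [e] at h5
    simp at h5
    rw [h3]
    congr 1
    omega

theorem sum_wt_le {s : ℤ} {F : ℤ → Option ℤ} (hF : GoodF s F) (hs : 0 < s) :
    ((∑ l ∈ Finset.Icc 0 (s - 1), wt s F l : ℕ) : ℤ) ≤ s := by
  classical
  rw [sum_wt hF hs]
  have : ((Finset.Ico 0 (s - 1 + s)).filter (fun n => ∃ l, F n = some l ∧ 0 ≤ l ∧ l ≤ s - 1)).card ≤
      (Finset.Ico 0 s).card := by
    apply Finset.card_le_card_of_injOn (fun n => n % s)
    · intro n hn
      simp only [Finset.coe_Ico, Set.mem_Ico]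
      exact ⟨Int.emod_nonneg _ (by omega), Int.emod_lt_of_pos _ hs⟩
    · intro n hn n' hn' he
      simp only [Finset.coe_filter, Set.mem_ofPred_eq] at hn hn' he
      obtain ⟨_, l, h1, h2⟩ := hn
      obtain ⟨_, l', h1', h2'⟩ := hn'
      obtain ⟨k, hk⟩ := Int.ModEq.dvd he
      have e : n' = n + s * k := by omega
      rw [e, ← sub_add_cancel l' (s * k), hF.shift_mul, h1] at h1'
      simp at h1'
      have hk0 : k = 0 := by
        have : s * k < s * 1 := by omega
        have h5 := lt_of_mul_lt_mul_left this hs.le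
        have : s * (-1) < s * k := by omega
        have h6 := lt_of_mul_lt_mul_left this hs.le
        omega
      subst hk0
      simp at e
      exact e.symm
  rw [Int.card_Ico] at this
  omega


structure GoodH (s : ℤ) (H : ℤ → ℤ) : Prop where
  step : ∀ n, H n - 1 ≤ H (n + 1)
  per : ∃ z, 0 ≤ z ∧ ∀ n, H (n + s) = H n - z

def FirstAt (H : ℤ → ℤ) (m l : ℤ) : Prop :=
  l ≤ m ∧ H l ≤ H (m + 1) ∧ ∀ i, l < i → i ≤ m → H (m + 1) < H i

theorem exists_FH (H : ℤ → ℤ) : ∃ F : ℤ → Option ℤ,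
    (∀ m l, F m = some l ↔ FirstAt H m l) ∧
    (∀ m i, i ≤ m → H i ≤ H (m + 1) → ∃ l, F m = some l ∧ i ≤ l) := by
  have key : ∀ m, ∃ v : Option ℤ, (∀ l, v = some l ↔ FirstAt H m l) ∧
    (∀ i, i ≤ m → H i ≤ H (m + 1) → ∃ l, v = some l ∧ i ≤ l) := by
    intro m
    by_cases hne : ∃ i, i ≤ m ∧ H i ≤ H (m + 1)
    · obtain ⟨l, ⟨hl1, hl2⟩, hl3⟩ := Int.exists_greatest_of_bdd (P := fun i => i ≤ m ∧ H i ≤ H (m + 1))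
        ⟨m, fun z hz => hz.1⟩ hne
      refine ⟨some l, ?_, ?_⟩
      · intro l'
        simp only [Option.some.injEq]
        constructor
        · rintro rfl
          refine ⟨hl1, hl2, fun i h1 h2 => ?_⟩
          by_contra hc
          have := hl3 i ⟨h2, by omega⟩
          omega
        · rintro ⟨h1, h2, h3⟩
          have := hl3 l' ⟨h1, h2⟩
          by_contra hc
          have := h3 l (by omega) hl1
          omega
      · intro i h1 h2
        exact ⟨l, rfl, hl3 i ⟨h1, h2⟩⟩
    · refine ⟨none, ?_, ?_⟩
      · intro l
        simp only [reduceCtorEq, false_iff]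
        rintro ⟨h1, h2, _⟩
        exact hne ⟨l, h1, h2⟩
      · intro i h1 h2
        exact absurd ⟨i, h1, h2⟩ hne
  choose F hF using key
  exact ⟨F, fun m => (hF m).1, fun m => (hF m).2⟩

theorem good_FH {s : ℤ} {H : ℤ → ℤ} (hH : GoodH s H) {F : ℤ → Option ℤ}
    (h1 : ∀ m l, F m = some l ↔ FirstAt H m l)
    (h2 : ∀ m i, i ≤ m → H i ≤ H (m + 1) → ∃ l, F m = some l ∧ i ≤ l) : GoodF s F := by
  obtain ⟨z, hz, hper⟩ := hH.per
  have hper' : ∀ n, H (n - s) = H n + z := by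
    intro n
    have := hper (n - s)
    simp at this
    omega
  constructor
  · intro m l h
    exact ((h1 m l).1 h).1
  · intro m l h
    rw [h1] at h ⊢
    obtain ⟨a, b, c⟩ := h
    refine ⟨le_rfl, ?_, fun i _ _ => by omega⟩
    rcases a.eq_or_lt with rfl | a
    · exact b
    · have := c (l + 1) (by omega) (by omega)
      omega
  · intro m l h
    rw [h1] at h ⊢
    obtain ⟨a, b, c⟩ := h
    have e : m + s + 1 = m + 1 + s := by ring
    refine ⟨by omega, ?_, ?_⟩
    · rw [e, hper, hper]; omega
    · intro i hi hi'
      have := c (i - s) (by omega) (by omega)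
      rw [hper'] at this
      rw [e, hper]
      omega
  · intro m l h
    rw [h1] at h ⊢
    obtain ⟨a, b, c⟩ := h
    have e : m + s + 1 = m + 1 + s := by ring
    rw [e, hper] at b c
    refine ⟨by omega, ?_, ?_⟩
    · rw [hper']; omega
    · intro i hi hi'
      have := c (i + s) (by omega) (by omega)
      rw [hper] at this
      omega
  · intro m l n h hl hn
    rw [h1] at h
    obtain ⟨a, b, c⟩ := h
    apply h2 n l hl
    rcases hn.eq_or_lt with rfl | hn
    · exact b
    · have := c (n + 1) (by omega) (by omega)
      omega

theorem wt_FH {s : ℤ} (hs : 0 < s) {H : ℤ → ℤ} (hH : GoodH s H) {F : ℤ → Option ℤ}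
    (h1 : ∀ m l, F m = some l ↔ FirstAt H m l) (hF : GoodF s F) (l : ℤ) :
    (wt s F l : ℤ) = H (l + 1) - H l + 1 := by
  obtain ⟨z, hz, hper⟩ := hH.per
  have hstep := hH.step l
  have : wt s F l = (Finset.Icc (H l) (H (l + 1))).card := by
    unfold wt
    apply Finset.card_bij (fun m _ => H (m + 1))
    · intro m hm
      simp only [Finset.mem_filter, Finset.mem_Ico, Finset.mem_Icc] at hm ⊢
      obtain ⟨a, b, c⟩ := (h1 _ _).1 hm.2
      refine ⟨b, ?_⟩
      rcases a.eq_or_lt with rfl | a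
      · exact le_rfl
      · exact (c (l + 1) (by omega) (by omega)).le
    · intro m hm m' hm' he
      simp only [Finset.mem_filter, Finset.mem_Ico] at hm hm'
      obtain ⟨a, b, c⟩ := (h1 _ _).1 hm.2
      obtain ⟨a', b', c'⟩ := (h1 _ _).1 hm'.2
      rcases lt_trichotomy m m' with h | h | h
      · have := c' (m + 1) (by omega) (by omega)
        omega
      · exact h
      · have := c (m' + 1) (by omega) (by omega)
        omega
    · intro v hv
      simp only [Finset.mem_Icc] at hv
      obtain ⟨n, ⟨hn1, hn2⟩, hn3⟩ := Int.exists_least_of_bdd (P := fun n => l + 1 ≤ n ∧ H n ≤ v)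
        ⟨l + 1, fun z hz => hz.1⟩ ⟨l + s, by omega, by rw [hper]; omega⟩
      have hnv : H n = v := by
        rcases hn1.eq_or_lt with rfl | h
        · omega
        · have a := hH.step (n - 1)
          rw [sub_add_cancel] at a
          by_contra hc
          have := hn3 (n - 1) ⟨by omega, by omega⟩
          omega
      have hfa : F (n - 1) = some l := by
        rw [h1]
        refine ⟨by omega, ?_, ?_⟩
        · rw [sub_add_cancel]; omega
        · intro i hi hi'
          rw [sub_add_cancel]
          by_contra hc
          have := hn3 i ⟨by omega, by omega⟩
          omega
      refine ⟨n - 1, ?_, by rw [sub_add_cancel]; exact hnv⟩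
      have := hF.lt hs _ _ hfa
      simp only [Finset.mem_filter, Finset.mem_Ico]
      exact ⟨by omega, hfa⟩
  rw [this, Int.card_Icc]
  omega

theorem exists_H (s : ℕ) (hs : 1 ≤ s) (u : ℕ → ℕ) (hu : ∑ i ∈ Finset.range s, u i ≤ s) :
    ∃ H : ℤ → ℤ, GoodH s H ∧ ∀ i : ℕ, i < s → H (i + 1) - H i + 1 = u i := by
  let f : ℕ → ℤ := fun i => (u i : ℤ) - 1
  let Z : ℤ := ∑ i ∈ Finset.range s, f i
  have hZ : Z ≤ 0 := by
    simp only [Z, f, Finset.sum_sub_distrib]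
    simp
    exact_mod_cast hu
  let H : ℤ → ℤ := fun n => (n / s) * Z + ∑ i ∈ Finset.range (n % s).toNat, f i
  have hs0 : (0 : ℤ) < s := by omega
  have hstep : ∀ n, H (n + 1) = H n + f (n % s).toNat := by
    intro n
    have a1 := Int.emod_nonneg n hs0.ne'
    have a2 := Int.emod_lt_of_pos n hs0
    have a3 := Int.mul_ediv_add_emod n s
    set q := n / s with hq
    set r := n % s with hr
    simp only [H, ← hq, ← hr]
    rcases (show r + 1 ≤ s by omega).eq_or_lt with h | h
    · have e : n + 1 = s * (q + 1) := by rw [mul_add]; omega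
      rw [e, Int.mul_ediv_cancel_left _ hs0.ne', Int.mul_emod_right]
      have e2 : s = r.toNat + 1 := by omega
      have : Z = ∑ i ∈ Finset.range r.toNat, f i + f r.toNat := by
        rw [← Finset.sum_range_succ, ← e2]
      simp
      rw [add_mul, this]
      ring
    · have e : n + 1 = (r + 1) + s * q := by omega
      rw [e, Int.add_mul_ediv_left _ _ hs0.ne', Int.add_mul_emod_self_left,
        Int.ediv_eq_zero_of_lt (by omega) h, Int.emod_eq_of_lt (by omega) h]
      have : (r + 1).toNat = r.toNat + 1 := by omega
      rw [this, Finset.sum_range_succ]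
      ring
  refine ⟨H, ⟨?_, ?_⟩, ?_⟩
  · intro n
    rw [hstep]
    simp only [f]
    omega
  · refine ⟨-Z, by omega, fun n => ?_⟩
    simp only [H]
    rw [Int.add_emod_right, Int.add_ediv_of_dvd_right (dvd_refl _), Int.ediv_self hs0.ne']
    ring
  · intro i hi
    rw [hstep, Int.emod_eq_of_lt (by omega) (by omega)]
    simp [f]


structure GoodR (s h : ℤ) (R : ℤ → ℤ → Prop) : Prop where
  refl : ∀ i, R i i
  symm : ∀ i j, R i j → R j i
  trans : ∀ i j k, R i j → R j k → R i k
  per : ∀ i k, R i (i + h * k)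
  shift : ∀ i j, R (i + s) (j + s) ↔ R i j
  nc : ∀ a b c d, a < b → b < c → c < d → d < a + h → R a c → R b d → R a b

namespace GoodR
variable {s h : ℤ} {R : ℤ → ℤ → Prop}

theorem zero_of (hR : GoodR s h R) {i j : ℤ} (hij : R i j) (hz : R i (i + s)) : R j (j + s) :=
  hR.trans _ _ _ (hR.trans _ _ _ (hR.symm _ _ hij) hz) ((hR.shift i j).2 hij)

theorem zero_of' (hR : GoodR s h R) {i j : ℤ} (hij : R i j) (hz : R j (j + s)) : R i (i + s) :=
  hR.zero_of (hR.symm _ _ hij) hz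

theorem unshift (hR : GoodR s h R) {i j : ℤ} (hij : R i j) : R (i - s) (j - s) := by
  rw [← hR.shift]; simpa using hij

theorem near (hR : GoodR s h R) (hs : 0 < s) {i j : ℤ} (hij : R i j) (h1 : i < j) (h2 : j < i + h)
    (hz : ¬ R i (i + s)) : j < i + s ∨ i + h - s < j := by
  by_contra hc
  push Not at hc
  rcases eq_or_lt_of_le hc.1 with h3 | h3
  · subst h3; exact hz hij
  rcases eq_or_lt_of_le hc.2 with h4 | h4
  · subst h4
    have a := (hR.shift _ _).2 hij
    have b := hR.per i 1
    have e : i + h - s + s = i + h * 1 := by ring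
    rw [e] at a
    exact hz (hR.trans _ _ _ b (hR.symm _ _ a))
  · exact hz (hR.nc i (i + s) j (j + s) (by omega) h3 (by omega) (by omega) hij ((hR.shift _ _).2 hij))

theorem zero_mul (hR : GoodR s h R) {i : ℤ} (hz : R i (i + s)) (k : ℤ) : R i (i + s * k) := by
  induction k using Int.induction_on with
  | zero => simpa using hR.refl i
  | succ n ih =>
    have e : i + s * ((n : ℤ) + 1) = i + s * n + s := by ring
    rw [e]
    exact hR.trans _ _ _ ih (hR.zero_of ih hz)
  | pred n ih =>
    have a := hR.unshift (hR.zero_of ih hz)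
    have e : i + s * (-(n : ℤ) - 1) = i + s * (-(n : ℤ)) - s := by ring
    rw [e]
    simp only [add_sub_cancel_right] at a
    exact hR.trans _ _ _ ih (hR.symm _ _ a)

theorem zero_zero (hR : GoodR s h R) (hs : 0 < s) (hh : 2 * s ≤ h) {i j : ℤ} (hi : R i (i + s))
    (hj : R j (j + s)) : R i j := by
  have a1 := Int.emod_nonneg (j - i) hs.ne'
  have a2 := Int.emod_lt_of_pos (j - i) hs
  have a3 := Int.mul_ediv_add_emod (j - i) s
  have b := hR.zero_mul hj (-((j - i) / s))
  set q := (j - i) / s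
  set r := (j - i) % s
  have e : j + s * (-q) = i + r := by rw [mul_neg]; omega
  rw [e] at b
  refine hR.trans _ _ _ ?_ (hR.symm _ _ b)
  rcases a1.eq_or_lt with h0 | h0
  · rw [← h0]; simpa using hR.refl i
  · exact hR.nc i (i + r) (i + s) (i + r + s) (by omega) (by omega) (by omega) (by omega) hi
      (hR.zero_of b hj)

end GoodR

def First (s : ℤ) (R : ℤ → ℤ → Prop) (m l : ℤ) : Prop :=
  l ≤ m ∧ m < l + s ∧ R l m ∧ ¬ R m (m + s) ∧ ∀ i, l - s < i → i < l → ¬ R i l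

theorem exists_FR {s h : ℤ} {R : ℤ → ℤ → Prop} (hR : GoodR s h R) (hs : 0 < s) (hh : 2 * s ≤ h) :
    ∃ F : ℤ → Option ℤ, (∀ m l, F m = some l ↔ First s R m l) ∧
      ∀ m, F m = none ↔ R m (m + s) := by
  have key : ∀ m, ∃ v : Option ℤ, (∀ l, v = some l ↔ First s R m l) ∧ (v = none ↔ R m (m + s)) := by
    intro m
    by_cases hz : R m (m + s)
    · refine ⟨none, ?_, by simpa using hz⟩
      intro l
      simp only [reduceCtorEq, false_iff]
      rintro ⟨_, _, _, h, _⟩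
      exact h hz
    · obtain ⟨l, ⟨hl1, hl2, hl3⟩, hl4⟩ := Int.exists_least_of_bdd
        (P := fun l => l ≤ m ∧ m < l + s ∧ R l m)
        ⟨m - s, fun z hz => by omega⟩ ⟨m, le_rfl, by omega, hR.refl m⟩
      have hfirst : First s R m l := by
        refine ⟨hl1, hl2, hl3, hz, ?_⟩
        intro i h1 h2 h3
        have him := hR.trans _ _ _ h3 hl3
        by_cases h4 : m < i + s
        · have := hl4 i ⟨by omega, h4, him⟩
          omega
        · rcases (not_lt.1 h4).eq_or_lt with h5 | h5
          · subst h5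
            exact hz (hR.zero_of him him)
          · have a := hR.nc (l - s) i (m - s) l (by omega) (by omega) (by omega) (by omega)
              (hR.unshift hl3) h3
            have b := hR.trans _ _ _ a h3
            have c := (hR.shift _ _).2 b
            rw [sub_add_cancel] at c
            exact hz (hR.zero_of hl3 c)
      refine ⟨some l, ?_, by simpa using hz⟩
      intro l'
      simp only [Option.some.injEq]
      constructor
      · rintro rfl; exact hfirst
      · rintro ⟨a, b, c, d, e⟩
        rcases lt_trichotomy l l' with h' | h' | h'
        · exact absurd (hR.trans _ _ _ hl3 (hR.symm _ _ c)) (e l (by omega) h')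
        · exact h'
        · exact absurd (hR.trans _ _ _ c (hR.symm _ _ hl3)) (hfirst.2.2.2.2 l' (by omega) h')
  choose F hF using key
  exact ⟨F, fun m => (hF m).1, fun m => (hF m).2⟩

theorem good_FR {s h : ℤ} {R : ℤ → ℤ → Prop} (hR : GoodR s h R) (hs : 0 < s) (hh : 2 * s ≤ h)
    {F : ℤ → Option ℤ} (h1 : ∀ m l, F m = some l ↔ First s R m l)
    (h2 : ∀ m, F m = none ↔ R m (m + s)) : GoodF s F := by
  have hfs : ∀ m l, First s R (m + s) (l + s) ↔ First s R m l := by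
    intro m l
    unfold First
    rw [hR.shift, hR.shift]
    refine and_congr (by omega) (and_congr (by omega) (and_congr Iff.rfl (and_congr Iff.rfl ?_)))
    constructor
    · intro H i hi hi'
      rw [← hR.shift]
      exact H (i + s) (by omega) (by omega)
    · intro H i hi hi' hr
      have := hR.unshift hr
      rw [add_sub_cancel_right] at this
      exact H (i - s) (by omega) (by omega) this
  constructor
  · intro m l h
    exact ((h1 m l).1 h).1
  · intro m l h
    rw [h1] at h ⊢
    obtain ⟨a, b, c, d, e⟩ := h
    exact ⟨le_rfl, by omega, hR.refl l, fun hz => d (hR.zero_of c hz), e⟩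
  · intro m l h
    rw [h1] at h ⊢
    exact (hfs m l).2 h
  · intro m l h
    rw [h1] at h ⊢
    rw [← hfs, sub_add_cancel]
    exact h
  · intro m l n h hl hn
    rcases hn.eq_or_lt with rfl | hn
    · exact ⟨l, h, le_rfl⟩
    rw [h1] at h
    obtain ⟨a, b, c, d, e⟩ := h
    rcases hl.eq_or_lt with rfl | hl
    · exact ⟨l, (h1 l l).2 ⟨le_rfl, by omega, hR.refl l, fun hz => d (hR.zero_of c hz), e⟩, le_rfl⟩
    cases hFn : F n with
    | none =>
      have hz := (h2 n).1 hFn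
      have := hR.nc l n m (n + s) hl hn (by omega) (by omega) c hz
      exact absurd (hR.zero_of c (hR.zero_of' this hz)) d
    | some l' =>
      refine ⟨l', rfl, ?_⟩
      obtain ⟨a', b', c', d', e'⟩ := (h1 n l').1 hFn
      by_contra hc
      exact e l' (by omega) (by omega) (hR.nc l' l n m (by omega) hl hn (by omega) c' c)

theorem FR_iff {s h : ℤ} {R : ℤ → ℤ → Prop} (hR : GoodR s h R) (hs : 0 < s) (hh : 2 * s ≤ h)
    {F : ℤ → Option ℤ} (h1 : ∀ m l, F m = some l ↔ First s R m l)
    (h2 : ∀ m, F m = none ↔ R m (m + s)) (m n : ℤ) :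
    R m n ↔ (F m = none ∧ F n = none) ∨ ∃ l k, F m = some l ∧ F n = some (l + h * k) := by
  constructor
  · intro hmn
    cases hm : F m with
    | none =>
      left
      exact ⟨rfl, (h2 n).2 (hR.zero_of hmn ((h2 m).1 hm))⟩
    | some l =>
      cases hn : F n with
      | none =>
        have := (h2 m).2 (hR.zero_of' hmn ((h2 n).1 hn))
        rw [hm] at this
        simp at this
      | some l' =>
        right
        refine ⟨l, (l' - l) / h, rfl, ?_⟩
        obtain ⟨a, b, c, d, e⟩ := (h1 m l).1 hm
        obtain ⟨a', b', c', d', e'⟩ := (h1 n l').1 hn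
        have hh0 : 0 < h := by omega
        have a1 := Int.emod_nonneg (l' - l) hh0.ne'
        have a2 := Int.emod_lt_of_pos (l' - l) hh0
        have a3 := Int.mul_ediv_add_emod (l' - l) h
        set q := (l' - l) / h
        set r := (l' - l) % h
        have hll' : R l l' := hR.trans _ _ _ (hR.trans _ _ _ c hmn) (hR.symm _ _ c')
        have hr : R l (l + r) := by
          have := hR.per l' (-q)
          have e : l' + h * (-q) = l + r := by rw [mul_neg]; omega
          rw [e] at this
          exact hR.trans _ _ _ hll' this
        have hzl : ¬ R l (l + s) := fun hz => d (hR.zero_of c hz)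
        rcases a1.eq_or_lt with h0 | h0
        · congr 1; omega
        · exfalso
          rcases hR.near hs hr (by omega) (by omega) hzl with h3 | h3
          · have h4 := hR.per l q
            exact e' (l + h * q) (by omega) (by omega)
              (hR.trans _ _ _ (hR.symm _ _ h4) hll')
          · have h4 := hR.per (l + r) (-1)
            exact e (l + r + h * (-1)) (by omega) (by omega)
              (hR.symm _ _ (hR.trans _ _ _ hr h4))
  · rintro (⟨hm, hn⟩ | ⟨l, k, hm, hn⟩)
    · exact hR.zero_zero hs hh ((h2 m).1 hm) ((h2 n).1 hn)
    · obtain ⟨a, b, c, d, e⟩ := (h1 _ _).1 hm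
      obtain ⟨a', b', c', d', e'⟩ := (h1 _ _).1 hn
      exact hR.trans _ _ _ (hR.symm _ _ c) (hR.trans _ _ _ (hR.per l k) c')


def RF (h : ℤ) (F : ℤ → Option ℤ) (m n : ℤ) : Prop :=
  (F m = none ∧ F n = none) ∨ ∃ l k, F m = some l ∧ F n = some (l + h * k)

theorem good_RF {s x : ℤ} (hs : 0 < s) (hx : 2 ≤ x) {F : ℤ → Option ℤ} (hF : GoodF s F) :
    GoodR s (s * x) (RF (s * x) F) := by
  have hh : 2 * s ≤ s * x := by nlinarith
  have hmul : ∀ k m l, F (m + s * x * k) = some (l + s * x * k) ↔ F m = some l := by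
    intro k m l
    rw [mul_assoc]
    exact hF.shift_mul (x * k) m l
  generalize hhx : s * x = h at *
  constructor
  · intro i
    unfold RF
    cases e : F i with
    | none => simp
    | some l => right; exact ⟨l, 0, rfl, by simp⟩
  · rintro i j (⟨a, b⟩ | ⟨l, k, a, b⟩)
    · exact Or.inl ⟨b, a⟩
    · exact Or.inr ⟨_, -k, b, by rw [a]; congr 1; ring⟩
  · rintro i j k (⟨a, b⟩ | ⟨l, t, a, b⟩) (⟨a', b'⟩ | ⟨l', t', a', b'⟩)
    · exact Or.inl ⟨a, b'⟩
    · rw [b] at a'; simp at a'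
    · rw [b] at a'; simp at a'
    · rw [b] at a'
      simp at a'
      subst a'
      exact Or.inr ⟨l, t + t', a, by rw [b']; congr 1; ring⟩
  · intro i k
    unfold RF
    cases e : F i with
    | none =>
      left
      refine ⟨rfl, ?_⟩
      cases e' : F (i + h * k) with
      | none => rfl
      | some l =>
        have := (hmul k i (l - h * k)).1 (by simpa using e')
        simp [e] at this
    | some l => right; exact ⟨l, k, rfl, (hmul _ _ _).2 e⟩
  · have hnone : ∀ i, F (i + s) = none ↔ F i = none := by
      intro i
      cases e : F i with
      | none =>
        cases e' : F (i + s) with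
        | none => rfl
        | some l =>
          have := hF.unshift _ _ e'
          simp [e] at this
      | some l => simp [hF.shift _ _ e]
    intro i j
    unfold RF
    rw [hnone, hnone]
    refine or_congr Iff.rfl ?_
    constructor
    · rintro ⟨l, k, a, b⟩
      refine ⟨l - s, k, hF.unshift _ _ a, ?_⟩
      rw [hF.unshift _ _ b]; congr 1; ring
    · rintro ⟨l, k, a, b⟩
      refine ⟨l + s, k, hF.shift _ _ a, ?_⟩
      rw [hF.shift _ _ b]; congr 1; ring
  · have krange : ∀ a c l k, a < c → c < a + h → F a = some l → F c = some (l + h * k) →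
        k = 0 ∨ k = 1 := by
      intro a c l k h1 h2 h3 h4
      have b1 := hF.le _ _ h3
      have b2 := hF.lt hs _ _ h3
      have b3 := hF.le _ _ h4
      have b4 := hF.lt hs _ _ h4
      have hh0 : 0 < h := by omega
      have h5 : -1 < k := lt_of_mul_lt_mul_left (show h * (-1) < h * k by omega) hh0.le
      have h6 : k < 2 := lt_of_mul_lt_mul_left (show h * k < h * 2 by omega) hh0.le
      omega
    intro a b c d hab hbc hcd hda hac hbd
    have up : ∀ l, F a = some l → F (a + h) = some (l + h) := by
      intro l hl
      have := (hmul 1 a l).2 hl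
      simpa using this
    have hle := hF.le
    have hnc := hF.nc
    rcases hac with ⟨fa, fc⟩ | ⟨l, k, fa, fc⟩
    · rcases hbd with ⟨fb, fd⟩ | ⟨l', k', fb, fd⟩
      · exact Or.inl ⟨fa, fb⟩
      · exfalso
        rcases krange b d l' k' (by omega) (by omega) fb fd with rfl | rfl
        · obtain ⟨t, h1, _⟩ := hnc d _ c fd (by have := hle _ _ fb; omega) (by omega)
          simp [fc] at h1
        · obtain ⟨t, h1, _⟩ := hnc b _ a fb (by have := hle _ _ fd; omega) (by omega)
          simp [fa] at h1
    · have la := hle _ _ fa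
      have lc := hle _ _ fc
      rcases hbd with ⟨fb, fd⟩ | ⟨l', k', fb, fd⟩
      · exfalso
        rcases krange a c l k (by omega) (by omega) fa fc with rfl | rfl
        · obtain ⟨t, h1, _⟩ := hnc c _ b fc (by omega) (by omega)
          simp [fb] at h1
        · obtain ⟨t, h1, _⟩ := hnc (a + h) _ d (up _ fa) (by omega) (by omega)
          simp [fd] at h1
      · have lb := hle _ _ fb
        have ld := hle _ _ fd
        right
        rcases krange a c l k (by omega) (by omega) fa fc with rfl | rfl <;>
          rcases krange b d l' k' (by omega) (by omega) fb fd with rfl | rfl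
        · obtain ⟨t, h1, h1'⟩ := hnc c _ b fc (by omega) (by omega)
          obtain ⟨t', h2, h2'⟩ := hnc d _ c fd (by omega) (by omega)
          rw [fb] at h1; rw [fc] at h2
          simp at h1 h2
          exact ⟨l, 0, fa, by rw [fb]; congr 1; omega⟩
        · obtain ⟨t, h1, h1'⟩ := hnc c _ b fc (by omega) (by omega)
          obtain ⟨t', h2, h2'⟩ := hnc b _ a fb (by omega) (by omega)
          rw [fb] at h1; rw [fa] at h2
          simp at h1 h2
          exact ⟨l, 0, fa, by rw [fb]; congr 1; omega⟩
        · obtain ⟨t, h1, h1'⟩ := hnc (a + h) _ d (up _ fa) (by omega) (by omega)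
          obtain ⟨t', h2, h2'⟩ := hnc d _ c fd (by omega) (by omega)
          rw [fd] at h1; rw [fc] at h2
          simp at h1 h2
          exact ⟨l, 1, fa, by rw [fb]; congr 1; omega⟩
        · obtain ⟨t, h1, h1'⟩ := hnc (a + h) _ d (up _ fa) (by omega) (by omega)
          obtain ⟨t', h2, h2'⟩ := hnc b _ a fb (by omega) (by omega)
          rw [fd] at h1; rw [fa] at h2
          simp at h1 h2
          exact ⟨l, 0, fa, by rw [fb]; congr 1; omega⟩

theorem RF_none {s x : ℤ} (hs : 0 < s) (hx : 2 ≤ x) {F : ℤ → Option ℤ} (hF : GoodF s F) (m : ℤ) :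
    F m = none ↔ RF (s * x) F m (m + s) := by
  have hh : 2 * s ≤ s * x := by nlinarith
  constructor
  · intro e
    left
    refine ⟨e, ?_⟩
    cases e' : F (m + s) with
    | none => rfl
    | some l =>
      have := hF.unshift _ _ e'
      simp [e] at this
  · rintro (⟨a, _⟩ | ⟨l, k, a, b⟩)
    · exact a
    · exfalso
      rw [hF.shift _ _ a] at b
      simp at b
      have hh0 : 0 < s * x := by omega
      have h5 : 0 < k := lt_of_mul_lt_mul_left (show s * x * 0 < s * x * k by omega) hh0.le
      have h6 : k < 1 := lt_of_mul_lt_mul_left (show s * x * k < s * x * 1 by omega) hh0.le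
      omega

theorem RF_inj_le {s x : ℤ} (hs : 0 < s) (hx : 2 ≤ x) {F F' : ℤ → Option ℤ} (hF : GoodF s F)
    (hF' : GoodF s F') (h : ∀ m n, RF (s * x) F m n → RF (s * x) F' m n) (m l l' : ℤ)
    (h1 : F m = some l) (h2 : F' m = some l') : l' ≤ l := by
  have hh : 2 * s ≤ s * x := by nlinarith
  have a : RF (s * x) F m l := Or.inr ⟨l, 0, h1, by rw [hF.idem _ _ h1]; simp⟩
  rcases h _ _ a with ⟨b, _⟩ | ⟨t, k, b, c⟩
  · simp [h2] at b
  · rw [h2] at b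
    simp at b
    subst b
    have b1 := hF.le _ _ h1
    have b2 := hF.lt hs _ _ h1
    have b3 := hF'.le _ _ h2
    have b4 := hF'.lt hs _ _ h2
    have b5 := hF'.le _ _ c
    have b6 := hF'.lt hs _ _ c
    have hh0 : 0 < s * x := by omega
    have h5 : -1 < k := lt_of_mul_lt_mul_left (show s * x * (-1) < s * x * k by omega) hh0.le
    have h7 : 0 ≤ s * x * k := mul_nonneg hh0.le (by omega)
    omega

theorem RF_inj {s x : ℤ} (hs : 0 < s) (hx : 2 ≤ x) {F F' : ℤ → Option ℤ} (hF : GoodF s F)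
    (hF' : GoodF s F') (h : ∀ m n, RF (s * x) F m n ↔ RF (s * x) F' m n) : F = F' := by
  funext m
  have h0 : F m = none ↔ F' m = none := by
    rw [RF_none hs hx hF, RF_none hs hx hF', h]
  cases e : F m with
  | none => exact (h0.1 e).symm
  | some l =>
    cases e' : F' m with
    | none => rw [h0.2 e'] at e; simp at e
    | some l' =>
      have := RF_inj_le hs hx hF hF' (fun m n => (h m n).1) m l l' e e'
      have := RF_inj_le hs hx hF' hF (fun m n => (h m n).2) m l' l e' e
      congr 1
      omega


def toFin (h : ℕ) (hh : 0 < h) (i : ℤ) : Fin h :=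
  ⟨(i % h).toNat, by
    have := Int.emod_lt_of_pos i (show (0 : ℤ) < h by omega)
    omega⟩

theorem toFin_val (h : ℕ) (hh : 0 < h) (i : ℤ) : ((toFin h hh i).val : ℤ) = i % h := by
  have := Int.emod_nonneg i (show (h : ℤ) ≠ 0 by omega)
  simp only [toFin]
  omega

theorem toFin_natCast (h : ℕ) (hh : 0 < h) (i : Fin h) : toFin h hh (i.val : ℤ) = i := by
  apply Fin.ext
  have := toFin_val h hh (i.val : ℤ)
  rw [Int.emod_eq_of_lt (by omega) (by omega)] at this
  omega

theorem toFin_per (h : ℕ) (hh : 0 < h) (i k : ℤ) : toFin h hh (i + h * k) = toFin h hh i := by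
  simp [toFin]

theorem toFin_rot (h s : ℕ) (hh : 0 < h) (i : ℤ) : rot h s (toFin h hh i) = toFin h hh (i + s) := by
  apply Fin.ext
  have h1 := toFin_val h hh (i + s)
  have h2 := toFin_val h hh i
  have h3 : ((rot h s (toFin h hh i)).val : ℤ) = (i + s) % h := by
    simp only [rot]
    push_cast
    rw [h2]
    simp
  omega

def relP {h : ℕ} (P : Set (Set (Fin h))) (i j : Fin h) : Prop := ∃ B ∈ P, i ∈ B ∧ j ∈ B

theorem part_eq {h : ℕ} {P : Set (Set (Fin h))} (hP : Setoid.IsPartition P) {B B' : Set (Fin h)}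
    {a : Fin h} (hB : B ∈ P) (hB' : B' ∈ P) (ha : a ∈ B) (ha' : a ∈ B') : B = B' :=
  Setoid.eq_of_mem_eqv_class hP.2 hB ha hB' ha'

theorem part_le_of_rel {h : ℕ} {P P' : Set (Set (Fin h))} (hP : Setoid.IsPartition P)
    (hP' : Setoid.IsPartition P') (H : ∀ i j, relP P i j ↔ relP P' i j) : P ⊆ P' := by
  intro B hB
  obtain ⟨a, ha⟩ := Setoid.nonempty_of_mem_partition hP hB
  obtain ⟨B', ⟨hB', ha'⟩, _⟩ := hP'.2 a
  have : B = B' := by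
    ext j
    constructor
    · intro hj
      obtain ⟨C, hC, h1, h2⟩ := (H a j).1 ⟨B, hB, ha, hj⟩
      rwa [part_eq hP' hB' hC ha' h1]
    · intro hj
      obtain ⟨C, hC, h1, h2⟩ := (H a j).2 ⟨B', hB', ha', hj⟩
      rwa [part_eq hP hB hC ha h1]
  rwa [this]

theorem emod_cases (h q y : ℤ) (hh : 0 < h) (h1 : h * q ≤ y) (h2 : y < h * q + 2 * h) :
    (y % h = y - h * q ∧ y - h * q < h) ∨ (y % h = y - h * q - h ∧ h ≤ y - h * q) := by
  rcases lt_or_ge (y - h * q) h with h3 | h3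
  · left
    refine ⟨?_, h3⟩
    have e : y = (y - h * q) + h * q := by ring
    rw [e, Int.add_mul_emod_self_left, Int.emod_eq_of_lt (by omega) (by omega)]
    omega
  · right
    refine ⟨?_, h3⟩
    have e : y = (y - h * q - h) + h * (q + 1) := by ring
    rw [e, Int.add_mul_emod_self_left, Int.emod_eq_of_lt (by omega) (by omega)]
    rw [mul_add]
    omega

theorem good_relP {s x h : ℕ} (hs : 1 ≤ s) (hx : 2 ≤ x) (hh : h = x * s) (h0 : 0 < h)
    {P : Set (Set (Fin h))} (hP : P ∈ NCA h) (hrot : RotInv h s P) :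
    GoodR (s : ℤ) (h : ℤ) (fun i j => relP P (toFin h h0 i) (toFin h h0 j)) := by
  obtain ⟨hpart, hnc⟩ := hP
  have symm : ∀ i j, relP P i j → relP P j i := by
    rintro i j ⟨B, hB, h1, h2⟩
    exact ⟨B, hB, h2, h1⟩
  have refl : ∀ i, relP P i i := by
    intro i
    obtain ⟨B, ⟨hB, ha⟩, _⟩ := hpart.2 i
    exact ⟨B, hB, ha, ha⟩
  have trans : ∀ i j k, relP P i j → relP P j k → relP P i k := by
    rintro i j k ⟨B, hB, h1, h2⟩ ⟨B', hB', h1', h2'⟩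
    rw [← part_eq hpart hB hB' h2 h1'] at h2'
    exact ⟨B, hB, h1, h2'⟩
  have nc : ∀ a b c d, a < b → b < c → c < d → relP P a c → relP P b d → relP P a b := by
    rintro a b c d hab hbc hcd ⟨B, hB, h1, h2⟩ ⟨B', hB', h1', h2'⟩
    by_cases hBB : B = B'
    · subst hBB
      exact ⟨B, hB, h1, h1'⟩
    · exact (hnc a b c d hab hbc hcd B hB B' hB' hBB h1 h2 h1' h2').elim
  have shift : ∀ i j : ℤ, relP P (toFin h h0 i) (toFin h h0 j) →
      relP P (toFin h h0 (i + s)) (toFin h h0 (j + s)) := by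
    rintro i j ⟨B, hB, h1, h2⟩
    refine ⟨_, hrot B hB, ?_, ?_⟩
    · rw [← toFin_rot]; exact ⟨_, h1, rfl⟩
    · rw [← toFin_rot]; exact ⟨_, h2, rfl⟩
  have shiftn : ∀ (n : ℕ) (i j : ℤ), relP P (toFin h h0 i) (toFin h h0 j) →
      relP P (toFin h h0 (i + s * n)) (toFin h h0 (j + s * n)) := by
    intro n
    induction n with
    | zero => intro i j H; simpa using H
    | succ n ih =>
      intro i j H
      have := shift _ _ (ih i j H)
      have e1 : ∀ i : ℤ, i + s * ((n + 1 : ℕ) : ℤ) = i + s * n + s := by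
        intro i; push_cast; ring
      rw [e1, e1]
      exact this
  constructor
  · intro i; exact refl _
  · intro i j; exact symm _ _
  · intro i j k; exact trans _ _ _
  · intro i k
    simp only [toFin_per]
    exact refl _
  · intro i j
    refine ⟨fun H => ?_, shift i j⟩
    have := shiftn (x - 1) _ _ H
    have e1 : ∀ i : ℤ, i + s + s * ((x - 1 : ℕ) : ℤ) = i + h * 1 := by
      intro i
      rw [hh]
      push_cast [Nat.cast_sub (show 1 ≤ x by omega)]
      ring
    rw [e1, e1, toFin_per, toFin_per] at this
    exact this
  · intro a b c d hab hbc hcd hda hac hbd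
    have hh0 : (0 : ℤ) < h := by omega
    have a1 := Int.emod_nonneg a hh0.ne'
    have a2 := Int.emod_lt_of_pos a hh0
    have a3 := Int.mul_ediv_add_emod a h
    have va := toFin_val h h0 a
    have vb := toFin_val h h0 b
    have vc := toFin_val h h0 c
    have vd := toFin_val h h0 d
    have hb := emod_cases h (a / h) b hh0 (by omega) (by omega)
    have hc := emod_cases h (a / h) c hh0 (by omega) (by omega)
    have hd := emod_cases h (a / h) d hh0 (by omega) (by omega)
    generalize toFin h h0 a = A at *
    generalize toFin h h0 b = B at *
    generalize toFin h h0 c = C at *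
    generalize toFin h h0 d = D at *
    rcases hd with hd | hd
    · exact nc A B C D (by rw [Fin.lt_def]; omega) (by rw [Fin.lt_def]; omega)
        (by rw [Fin.lt_def]; omega) hac hbd
    rcases hc with hc | hc
    · have := nc D A B C (by rw [Fin.lt_def]; omega) (by rw [Fin.lt_def]; omega)
        (by rw [Fin.lt_def]; omega) (symm _ _ hbd) hac
      exact trans _ _ _ (symm _ _ this) (symm _ _ hbd)
    rcases hb with hb | hb
    · have := nc C D A B (by rw [Fin.lt_def]; omega) (by rw [Fin.lt_def]; omega)
        (by rw [Fin.lt_def]; omega) (symm _ _ hac) (symm _ _ hbd)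
      exact trans _ _ _ hac (trans _ _ _ this (symm _ _ hbd))
    · have := nc B C D A (by rw [Fin.lt_def]; omega) (by rw [Fin.lt_def]; omega)
        (by rw [Fin.lt_def]; omega) hbd (symm _ _ hac)
      exact trans _ _ _ hac (symm _ _ this)

def setoidOf {s h : ℤ} {R : ℤ → ℤ → Prop} (hR : GoodR s h R) (n : ℕ) : Setoid (Fin n) where
  r i j := R i.val j.val
  iseqv := ⟨fun _ => hR.refl _, fun h => hR.symm _ _ h, fun h h' => hR.trans _ _ _ h h'⟩

theorem relP_setoidOf {s h : ℤ} {R : ℤ → ℤ → Prop} (hR : GoodR s h R) (n : ℕ) (i j : Fin n) :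
    relP (setoidOf hR n).classes i j ↔ R i.val j.val := by
  unfold relP
  rw [← Setoid.rel_iff_exists_classes]
  rfl

theorem GoodR.toFin_right {s : ℤ} {n : ℕ} {R : ℤ → ℤ → Prop} (hR : GoodR s n R) (hn : 0 < n) (i : ℤ) :
    R i ((toFin n hn i).val : ℤ) := by
  rw [toFin_val]
  have := hR.per i (-(i / n))
  have e : i + n * (-(i / n)) = i % n := by
    have := Int.mul_ediv_add_emod i n
    rw [mul_neg]
    omega
  rwa [e] at this

theorem relP_toFin {s : ℤ} {n : ℕ} {R : ℤ → ℤ → Prop} (hR : GoodR s n R) (hn : 0 < n) (i j : ℤ) :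
    relP (setoidOf hR n).classes (toFin n hn i) (toFin n hn j) ↔ R i j := by
  rw [relP_setoidOf]
  have h1 := hR.toFin_right hn i
  have h2 := hR.toFin_right hn j
  exact ⟨fun H => hR.trans _ _ _ h1 (hR.trans _ _ _ H (hR.symm _ _ h2)),
    fun H => hR.trans _ _ _ (hR.symm _ _ h1) (hR.trans _ _ _ H h2)⟩

theorem classes_mem {s h : ℕ} (h0 : 0 < h) {R : ℤ → ℤ → Prop} (hR : GoodR (s : ℤ) (h : ℤ) R) :
    (setoidOf hR h).classes ∈ NCA h ∧ RotInv h s (setoidOf hR h).classes := by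
  refine ⟨⟨Setoid.isPartition_classes _, ?_⟩, ?_⟩
  · intro a b c d hab hbc hcd B hB B' hB' hne ha hc hb hd
    have h1 : R a.val c.val := (relP_setoidOf hR h a c).1 ⟨B, hB, ha, hc⟩
    have h2 : R b.val d.val := (relP_setoidOf hR h b d).1 ⟨B', hB', hb, hd⟩
    rw [Fin.lt_def] at hab hbc hcd
    have h3 := hR.nc a.val b.val c.val d.val (by omega) (by omega) (by omega) (by omega) h1 h2
    obtain ⟨C, hC, h4, h5⟩ := (relP_setoidOf hR h a b).2 h3
    apply hne
    rw [part_eq (Setoid.isPartition_classes _) hB hC ha h4,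
      part_eq (Setoid.isPartition_classes _) hB' hC hb h5]
  · rintro B ⟨y, rfl⟩
    refine ⟨rot h s y, ?_⟩
    have hrel : ∀ i j : Fin h, setoidOf hR h i j ↔ R i.val j.val := fun _ _ => Iff.rfl
    have hrotR : ∀ i : Fin h, R (i.val + s) ((rot h s i).val : ℤ) := by
      intro i
      have := hR.toFin_right h0 (i.val + s)
      rwa [← toFin_rot, toFin_natCast] at this
    ext j
    constructor
    · rintro ⟨i, hi, rfl⟩
      have hi' : R i.val y.val := hi
      show R _ _
      exact hR.trans _ _ _ (hR.symm _ _ (hrotR i))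
        (hR.trans _ _ _ ((hR.shift _ _).2 hi') (hrotR y))
    · intro hj
      have hj' : R j.val (rot h s y).val := hj
      refine ⟨toFin h h0 (j.val - s), ?_, ?_⟩
      · show R _ _
        have h1 := hR.toFin_right h0 (j.val - s)
        have h2 := hR.trans _ _ _ hj' (hR.symm _ _ (hrotR y))
        have h3 := hR.unshift h2
        rw [add_sub_cancel_right] at h3
        exact hR.trans _ _ _ (hR.symm _ _ h1) h3
      · rw [toFin_rot, sub_add_cancel, toFin_natCast]


theorem inj1 {s x h : ℕ} (hs : 1 ≤ s) (hx : 2 ≤ x) (hh : h = x * s) (h0 : 0 < h) :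
    ∃ f : {P : Set (Set (Fin h)) // P ∈ NCA h ∧ RotInv h s P} → {F // GoodF (s : ℤ) F},
      Function.Injective f := by
  have h2s : 2 * (s : ℤ) ≤ h := by
    have : 2 * s ≤ h := by rw [hh]; exact Nat.mul_le_mul_right s hx
    omega
  have hs0 : (0 : ℤ) < s := by omega
  have key : ∀ P : {P : Set (Set (Fin h)) // P ∈ NCA h ∧ RotInv h s P},
      ∃ F : {F // GoodF (s : ℤ) F}, ∀ i j : ℤ, relP P.1 (toFin h h0 i) (toFin h h0 j) ↔
        RF h F.1 i j := by
    rintro ⟨P, hP, hrot⟩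
    have hR := good_relP hs hx hh h0 hP hrot
    obtain ⟨F, h1, h2⟩ := exists_FR hR hs0 h2s
    exact ⟨⟨F, good_FR hR hs0 h2s h1 h2⟩, FR_iff hR hs0 h2s h1 h2⟩
  choose f hf using key
  refine ⟨f, ?_⟩
  intro P P' he
  have : ∀ i j, relP P.1 i j ↔ relP P'.1 i j := by
    intro i j
    have h1 := hf P i.val j.val
    have h2 := hf P' i.val j.val
    rw [toFin_natCast, toFin_natCast] at h1 h2
    rw [h1, h2, he]
  apply Subtype.ext
  exact (part_le_of_rel P.2.1.1 P'.2.1.1 this).antisymm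
    (part_le_of_rel P'.2.1.1 P.2.1.1 fun i j => (this i j).symm)

theorem inj4 {s x h : ℕ} (hs : 1 ≤ s) (hx : 2 ≤ x) (hh : h = x * s) (h0 : 0 < h) :
    ∃ f : {F // GoodF (s : ℤ) F} → {P : Set (Set (Fin h)) // P ∈ NCA h ∧ RotInv h s P},
      Function.Injective f := by
  have hs0 : (0 : ℤ) < s := by omega
  have hx0 : (2 : ℤ) ≤ x := by omega
  have hhz : (h : ℤ) = s * x := by rw [hh]; push_cast; ring
  have key : ∀ F : {F // GoodF (s : ℤ) F},
      ∃ P : {P : Set (Set (Fin h)) // P ∈ NCA h ∧ RotInv h s P},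
        ∀ i j : ℤ, relP P.1 (toFin h h0 i) (toFin h h0 j) ↔ RF (s * x) F.1 i j := by
    rintro ⟨F, hF⟩
    have hR := good_RF hs0 hx0 hF
    rw [← hhz] at hR ⊢
    exact ⟨⟨_, classes_mem h0 hR⟩, relP_toFin hR h0⟩
  choose f hf using key
  refine ⟨f, ?_⟩
  intro F F' he
  apply Subtype.ext
  apply RF_inj hs0 hx0 F.2 F'.2
  intro m n
  rw [← hf, ← hf, he]

abbrev WW (s : ℕ) := {u : Fin (s + 1) →₀ ℕ // u ∈ Finset.finsuppAntidiag Finset.univ s}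

theorem WW_sum {s : ℕ} (u : WW s) : ∑ i : Fin s, u.1 i.castSucc + u.1 (Fin.last s) = s := by
  have := u.2
  rw [Finset.mem_finsuppAntidiag] at this
  have h1 := this.1
  rw [Fin.sum_univ_castSucc] at h1
  exact h1

theorem WW_ext {s : ℕ} (u v : WW s) (h : ∀ i : Fin s, u.1 i.castSucc = v.1 i.castSucc) : u = v := by
  have h1 := WW_sum u
  have h2 := WW_sum v
  simp only [h] at h1
  apply Subtype.ext
  ext i
  refine Fin.lastCases ?_ ?_ i
  · omega
  · exact h

theorem inj2 {s : ℕ} (hs : 1 ≤ s) :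
    ∃ f : {F // GoodF (s : ℤ) F} → WW s, Function.Injective f := by
  have hs0 : (0 : ℤ) < s := by omega
  have key : ∀ F : {F // GoodF (s : ℤ) F}, ∃ u : WW s, ∀ i : Fin s, u.1 i.castSucc = wt s F.1 i.val := by
    rintro ⟨F, hF⟩
    have hle := sum_wt_le hF hs0
    have e : ∑ l ∈ Finset.Icc (0 : ℤ) (s - 1), wt s F l = ∑ i : Fin s, wt s F i.val := by
      symm
      apply Finset.sum_bij (fun (i : Fin s) _ => (i.val : ℤ))
      · intro i _
        simp only [Finset.mem_Icc]
        omega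
      · intro i _ j _ h
        apply Fin.ext
        omega
      · intro b hb
        simp only [Finset.mem_Icc] at hb
        exact ⟨⟨b.toNat, by omega⟩, Finset.mem_univ _, by simp; omega⟩
      · intro i _; rfl
    rw [e] at hle
    refine ⟨⟨Finsupp.equivFunOnFinite.symm
      (Fin.snoc (α := fun _ => ℕ) (fun i : Fin s => wt s F i.val) (s - ∑ i : Fin s, wt s F i.val)), ?_⟩, ?_⟩
    · rw [Finset.mem_finsuppAntidiag]
      refine ⟨?_, Finset.subset_univ _⟩
      rw [Fin.sum_univ_castSucc]
      simp
      omega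
    · intro i
      simp
  choose f hf using key
  refine ⟨f, ?_⟩
  intro F F' he
  apply Subtype.ext
  apply F_eq_of_wt F.2 F'.2 hs0
  intro l
  have a1 := Int.emod_nonneg l hs0.ne'
  have a2 := Int.emod_lt_of_pos l hs0
  have a3 := Int.mul_ediv_add_emod l s
  have e1 := wt_shift F.2 (l / s) (l % s)
  have e2 := wt_shift F'.2 (l / s) (l % s)
  rw [show l % s + s * (l / s) = l by omega] at e1 e2
  rw [e1, e2]
  have h1 := hf F ⟨(l % s).toNat, by omega⟩
  have h2 := hf F' ⟨(l % s).toNat, by omega⟩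
  have e3 : (((l % s).toNat : ℕ) : ℤ) = l % s := by omega
  simp only [e3] at h1 h2
  rw [← h1, ← h2, he]

theorem inj3 {s : ℕ} (hs : 1 ≤ s) :
    ∃ f : WW s → {F // GoodF (s : ℤ) F}, Function.Injective f := by
  have hs0 : (0 : ℤ) < s := by omega
  have key : ∀ u : WW s, ∃ F : {F // GoodF (s : ℤ) F}, ∀ i : Fin s, u.1 i.castSucc = wt s F.1 i.val := by
    intro u
    have hsum := WW_sum u
    let v : ℕ → ℕ := fun i => if hi : i < s then u.1 (Fin.castSucc ⟨i, hi⟩) else 0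
    have hv : ∑ i ∈ Finset.range s, v i ≤ s := by
      rw [Finset.sum_range]
      simp only [v, Fin.is_lt, dite_true, Fin.eta]
      omega
    obtain ⟨H, hH, hHu⟩ := exists_H s hs v hv
    obtain ⟨F, h1, h2⟩ := exists_FH H
    have hF := good_FH hH h1 h2
    refine ⟨⟨F, hF⟩, fun i => ?_⟩
    have h3 := wt_FH hs0 hH h1 hF i.val
    rw [hHu i.val i.isLt] at h3
    simp only [v, Fin.is_lt, dite_true, Fin.eta] at h3
    exact_mod_cast h3.symm
  choose f hf using key
  refine ⟨f, ?_⟩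
  intro u v he
  apply WW_ext
  intro i
  rw [hf u, hf v, he]

theorem card_WW (s : ℕ) : Nat.card (WW s) = (2 * s).choose s := by
  rw [Nat.card_eq_fintype_card, Fintype.card_coe, Finset.card_finsuppAntidiag_nat_eq_choose]
  simp
  congr 1
  omega

/-- Let `s ≥ 1`, `x ≥ 2` and `h = x·s`. The number of elements of `NC^A(h)` invariant under
the rotation `ρ_s` equals `(s+1)·C_s = C(2s, s)`. -/
theorem number_of_rho_s_invariant_noncrossing_partitions
    (s x h : ℕ) (hs : 1 ≤ s) (hx : 2 ≤ x) (hh : h = x * s) :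
    Nat.card {P : Set (Set (Fin h)) // P ∈ NCA h ∧ RotInv h s P} = (s + 1) * catalan s ∧
      (s + 1) * catalan s = (2 * s).choose s := by
  have hc : (s + 1) * catalan s = (2 * s).choose s := by
    rw [succ_mul_catalan_eq_centralBinom, Nat.centralBinom_eq_two_mul_choose]
  refine ⟨?_, hc⟩
  rw [hc, ← card_WW]
  have h0 : 0 < h := by rw [hh]; positivity
  obtain ⟨f1, i1⟩ := inj1 hs hx hh h0
  obtain ⟨f2, i2⟩ := inj2 hs
  obtain ⟨f3, i3⟩ := inj3 hs
  obtain ⟨f4, i4⟩ := inj4 hs hx hh h0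
  exact le_antisymm (Nat.card_le_card_of_injective _ (i2.comp i1))
    (Nat.card_le_card_of_injective _ (i4.comp i3))
end

section
/- Let s ≥ 1 and x ≥ 2 be integers and set h = x·s. For every element π of NC^A(h) that is invariant under ρ_s, the collection of images of the blocks of π under the reduction map {0,…,h−1} → {0,…,s−1}, i ↦ i mod s, is a noncrossing partition F(π) of {0,…,s−1}; moreover, the resulting map F from the set of ρ_s-invariant elements of NC^A(h) to NC^A(s) is surjective, and for every w ∈ NC^A(s) the fiber F⁻¹(w) has exactly s+1 elements. -/
/-- The reduction map `{0,…,h-1} → {0,…,s-1}`, `i ↦ i mod s`. -/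
def red (h s : ℕ) (hs : 0 < s) (i : Fin h) : Fin s := ⟨i.val % s, Nat.mod_lt _ hs⟩

/-- The map `F` sending a partition of `{0,…,h-1}` to the collection of images of its blocks
under the reduction map. -/
def Fmap (h s : ℕ) (hs : 0 < s) (P : Set (Set (Fin h))) : Set (Set (Fin s)) :=
  (fun B => red h s hs '' B) '' P

namespace NCRed

structure Good (m : ℤ) (R : ℤ → ℤ → Prop) : Prop where
  eqv : Equivalence R
  per : ∀ i, R i (i + m)
  nc : ∀ a b c d, a < b → b < c → c < d → d < a + m → R a c → R b d → R a b

theorem per_mul {m : ℤ} {R : ℤ → ℤ → Prop} (e : Equivalence R) (per : ∀ i, R i (i + m))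
    (i k : ℤ) : R i (i + m * k) := by
  induction k using Int.induction_on with
  | zero => simpa using e.refl i
  | succ n ih =>
    have := e.trans ih (per _)
    rwa [show i + m * (n:ℤ) + m = i + m * ((n:ℤ) + 1) by ring] at this
  | pred n ih =>
    have := per (i + m * (-(n:ℤ) - 1))
    rw [show i + m * (-(n:ℤ) - 1) + m = i + m * (-(n:ℤ)) by ring] at this
    exact e.trans ih (e.symm this)

theorem nc_of_window {m : ℤ} {R : ℤ → ℤ → Prop} (hm : 0 < m) (e : Equivalence R)
    (per : ∀ i, R i (i + m)) (p : ℤ)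
    (H : ∀ a b c d, p ≤ a → a < b → b < c → c < d → d < p + m → R a c → R b d → R a b) :
    ∀ a b c d, a < b → b < c → c < d → d < a + m → R a c → R b d → R a b := by
  have key : ∀ a b c d, p ≤ a → a < p + m → a < b → b < c → c < d → d < a + m →
      R a c → R b d → R a b := by
    intro a b c d h0 h1 hab hbc hcd hda hac hbd
    have sh : ∀ i, R (i - m) i := fun i => by simpa using per (i - m)
    by_cases h2 : d < p + m
    · exact H a b c d h0 hab hbc hcd h2 hac hbd
    by_cases h3 : c < p + m
    · have := H (d - m) a b c (by omega) (by omega) hab hbc h3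
        (e.trans (sh d) (e.symm hbd)) hac
      exact e.trans (e.symm this) (e.trans (sh d) (e.symm hbd))
    by_cases h4 : b < p + m
    · have := H (c - m) (d - m) a b (by omega) (by omega) (by omega) hab h4
        (e.trans (sh c) (e.symm hac)) (e.trans (sh d) (e.symm hbd))
      exact e.trans hac (e.trans (e.symm (sh c)) (e.trans this (e.trans (sh d) (e.symm hbd))))
    · have := H (b - m) (c - m) (d - m) a (by omega) (by omega) (by omega) (by omega) (by omega)
        (e.trans (sh b) (e.trans hbd (e.symm (sh d)))) (e.trans (sh c) (e.symm hac))
      exact e.trans hac (e.trans (e.symm (sh c)) (e.trans (e.symm this) (sh b)))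
  intro a b c d hab hbc hcd hda hac hbd
  have h1 := Int.emod_nonneg (a - p) hm.ne'
  have h2 := Int.emod_lt_of_pos (a - p) hm
  have h3 := Int.emod_add_mul_ediv (a - p) m
  have hk := fun i => per_mul e per i (-((a - p) / m))
  have h4 : m * (-((a - p) / m)) = - (m * ((a-p)/m)) := by ring
  simp only [h4] at hk
  generalize m * ((a-p)/m) = t at *
  have := key (a + -t) (b + -t) (c + -t) (d + -t) (by omega) (by omega) (by omega) (by omega)
    (by omega) (by omega) (e.trans (e.symm (hk a)) (e.trans hac (hk c)))
    (e.trans (e.symm (hk b)) (e.trans hbd (hk d)))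
  exact e.trans (hk a) (e.trans this (e.symm (hk b)))

theorem Good.mul {m : ℤ} {R : ℤ → ℤ → Prop} (g : Good m R) (i k : ℤ) : R i (i + m * k) :=
  per_mul g.eqv g.per i k

theorem Good.emod {m : ℤ} {R : ℤ → ℤ → Prop} (g : Good m R) (i : ℤ) : R (i % m) i := by
  have := g.mul (i % m) (i / m)
  rwa [Int.emod_add_mul_ediv] at this

def part (m : ℕ) (R : ℤ → ℤ → Prop) : Set (Set (Fin m)) :=
  {B | ∃ i : Fin m, B = {j : Fin m | R (i.val : ℤ) (j.val : ℤ)}}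

def cl (m : ℕ) (hm : 0 < m) (i : ℤ) : Fin m :=
  ⟨(i % m).toNat, by
    have h1 := Int.emod_nonneg i (b := (m:ℤ)) (by omega)
    have h2 := Int.emod_lt_of_pos i (b := (m:ℤ)) (by omega)
    omega⟩

theorem cl_val (m : ℕ) (hm : 0 < m) (i : ℤ) : ((cl m hm i).val : ℤ) = i % m := by
  have h1 := Int.emod_nonneg i (b := (m:ℤ)) (by omega)
  simp [cl, h1]

theorem cl_fin (m : ℕ) (hm : 0 < m) (i : Fin m) : cl m hm (i.val : ℤ) = i := by
  apply Fin.ext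
  have := cl_val m hm i.val
  have h2 := Int.emod_eq_of_lt (a := (i.val:ℤ)) (b := m) (by omega) (by have := i.2; omega)
  omega

theorem Good.cl {m : ℕ} {R : ℤ → ℤ → Prop} (g : Good m R) (hm : 0 < m) (i : ℤ) :
    R ((cl m hm i).val : ℤ) i := by
  rw [cl_val]; exact g.emod i

theorem exists_rel {m : ℕ} (hm : 0 < m) {P : Set (Set (Fin m))} (hP : P ∈ NCA m) :
    ∃ R, Good m R ∧ P = part m R := by
  obtain ⟨hp, hn⟩ := hP
  have ex : ∀ a : Fin m, ∃ B ∈ P, a ∈ B := fun a => (hp.2 a).exists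
  have un : ∀ (a : Fin m) B B', B ∈ P → B' ∈ P → a ∈ B → a ∈ B' → B = B' := by
    intro a B B' h1 h2 h3 h4
    exact (hp.2 a).unique ⟨h1, h3⟩ ⟨h2, h4⟩
  let R : ℤ → ℤ → Prop := fun i j => ∃ B ∈ P, cl m hm i ∈ B ∧ cl m hm j ∈ B
  have e : Equivalence R := by
    refine ⟨?_, ?_, ?_⟩
    · intro i
      obtain ⟨B, hB, h⟩ := ex (NCRed.cl m hm i)
      exact ⟨B, hB, h, h⟩
    · rintro i j ⟨B, hB, h, h'⟩
      exact ⟨B, hB, h', h⟩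
    · rintro i j k ⟨B, hB, h, h'⟩ ⟨B', hB', h2, h3⟩
      have := un _ _ _ hB hB' h' h2
      subst this
      exact ⟨B, hB, h, h3⟩
  have per : ∀ i, R i (i + m) := by
    intro i
    have : NCRed.cl m hm (i + m) = NCRed.cl m hm i := by
      apply Fin.ext; simp [NCRed.cl]
    obtain ⟨B, hB, h⟩ := ex (NCRed.cl m hm i)
    exact ⟨B, hB, h, this ▸ h⟩
  refine ⟨R, ⟨e, per, ?_⟩, ?_⟩
  · refine nc_of_window (by omega) e per 0 ?_
    rintro a b c d h0 hab hbc hcd hd ⟨B, hB, h1, h2⟩ ⟨B', hB', h3, h4⟩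
    by_cases hBB : B = B'
    · subst hBB; exact ⟨B, hB, h1, h3⟩
    · exfalso
      have lt : ∀ i j : ℤ, 0 ≤ i → i < j → j < 0 + m → NCRed.cl m hm i < NCRed.cl m hm j := by
        intro i j h0 hij hj
        have h1 := cl_val m hm i
        have h2 := cl_val m hm j
        rw [Int.emod_eq_of_lt (by omega) (by omega)] at h1 h2
        rw [Fin.lt_def]; omega
      exact hn _ _ _ _ (lt a b (by omega) hab (by omega)) (lt b c (by omega) hbc (by omega))
        (lt c d (by omega) hcd (by omega)) B hB B' hB' hBB h1 h2 h3 h4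
  · ext B
    constructor
    · intro hB
      have hne : B.Nonempty := by
        by_contra h
        rw [Set.not_nonempty_iff_eq_empty] at h
        subst h; exact hp.1 hB
      obtain ⟨i, hi⟩ := hne
      refine ⟨i, ?_⟩
      ext j
      simp only [R, cl_fin, Set.mem_ofPred_eq]
      constructor
      · intro hj; exact ⟨B, hB, hi, hj⟩
      · rintro ⟨B', hB', h1, h2⟩
        rwa [un i B B' hB hB' hi h1]
    · rintro ⟨i, rfl⟩
      obtain ⟨B, hB, hi⟩ := ex i
      convert hB
      ext j
      simp only [R, cl_fin, Set.mem_ofPred_eq]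
      constructor
      · rintro ⟨B', hB', h1, h2⟩
        rwa [un i B B' hB hB' hi h1]
      · intro hj; exact ⟨B, hB, hi, hj⟩

theorem part_mem {m : ℕ} {R : ℤ → ℤ → Prop} (g : Good m R) : part m R ∈ NCA m := by
  refine ⟨⟨?_, ?_⟩, ?_⟩
  · rintro ⟨i, hi⟩
    have : i ∈ (∅ : Set (Fin m)) := by rw [hi]; exact g.eqv.refl _
    exact this
  · intro a
    refine ⟨{j : Fin m | R (a.val : ℤ) (j.val : ℤ)}, ⟨⟨a, rfl⟩, g.eqv.refl _⟩, ?_⟩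
    rintro B ⟨⟨i, rfl⟩, hi⟩
    ext j
    exact ⟨fun h => g.eqv.trans (g.eqv.symm hi) h, fun h => g.eqv.trans hi h⟩
  · rintro a b c d hab hbc hcd _ ⟨i, rfl⟩ _ ⟨k, rfl⟩ hne ha hc hb hd
    apply hne
    simp only [Set.mem_ofPred_eq] at ha hb hc hd
    have := g.nc a.val b.val c.val d.val (by exact_mod_cast hab) (by exact_mod_cast hbc)
      (by exact_mod_cast hcd) (by have := d.2; omega) (g.eqv.trans (g.eqv.symm ha) hc)
      (g.eqv.trans (g.eqv.symm hb) hd)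
    have h2 : R i.val k.val := g.eqv.trans ha (g.eqv.trans this (g.eqv.symm hb))
    ext j
    exact ⟨fun h => g.eqv.trans (g.eqv.symm h2) h, fun h => g.eqv.trans h2 h⟩

theorem part_sub {m : ℕ} (hm : 0 < m) {R R' : ℤ → ℤ → Prop} (g : Good m R) (g' : Good m R')
    (h : part m R = part m R') (i j : ℤ) (hij : R i j) : R' i j := by
  have h1 : {b : Fin m | R ((NCRed.cl m hm i).val : ℤ) (b.val : ℤ)} ∈ part m R' := by
    rw [← h]; exact ⟨_, rfl⟩
  obtain ⟨k, hk⟩ := h1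
  have mem : ∀ b : Fin m, R ((NCRed.cl m hm i).val : ℤ) (b.val : ℤ) ↔ R' k.val b.val := by
    intro b
    exact Set.ext_iff.mp hk b
  have a1 := (mem (NCRed.cl m hm i)).1 (g.eqv.refl _)
  have a2 := (mem (NCRed.cl m hm j)).1
    (g.eqv.trans (g.cl hm i) (g.eqv.trans hij (g.eqv.symm (g.cl hm j))))
  exact g'.eqv.trans (g'.eqv.symm (g'.cl hm i)) (g'.eqv.trans (g'.eqv.symm a1)
    (g'.eqv.trans a2 (g'.cl hm j)))

theorem part_inj {m : ℕ} (hm : 0 < m) {R R' : ℤ → ℤ → Prop} (g : Good m R) (g' : Good m R')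
    (h : part m R = part m R') : R = R' := by
  funext i j
  exact propext ⟨part_sub hm g g' h i j, part_sub hm g' g h.symm i j⟩

def Inv (s : ℤ) (R : ℤ → ℤ → Prop) : Prop := ∀ i j, R i j → R (i + s) (j + s)

theorem rot_rel {m s : ℕ} {R : ℤ → ℤ → Prop} (g : Good m R) (i : Fin m) :
    R ((rot m s i).val : ℤ) ((i.val : ℤ) + s) := by
  have := g.emod ((i.val:ℤ) + s)
  simpa [rot] using this

theorem inv_of_rotInv {m s : ℕ} (hm : 0 < m) {R : ℤ → ℤ → Prop} (g : Good m R)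
    (h : RotInv m s (part m R)) : Inv s R := by
  intro i j hij
  obtain ⟨k, hk⟩ := h _ ⟨NCRed.cl m hm i, rfl⟩
  have e := g.eqv
  have aux : ∀ l, R i l → R k.val (l + s) := by
    intro l hl
    have h1 : rot m s (NCRed.cl m hm l) ∈ {j : Fin m | R (k.val : ℤ) (j.val : ℤ)} := by
      rw [← hk]
      exact ⟨_, e.trans (g.cl hm i) (e.trans hl (e.symm (g.cl hm l))), rfl⟩
    have h2 := rot_rel (s := s) g (NCRed.cl m hm l)
    have h3 : R (((NCRed.cl m hm l).val : ℤ) + s) (l + s) := by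
      have h4 := g.mul (((NCRed.cl m hm l).val : ℤ) + s) (l / m)
      rw [cl_val] at h4 ⊢
      have h5 := Int.emod_add_mul_ediv l m
      rwa [show l % m + (s:ℤ) + m * (l / m) = l + s by linarith] at h4
    exact e.trans h1 (e.trans h2 h3)
  exact e.trans (e.symm (aux i (e.refl i))) (aux j hij)

theorem Inv.mul {s m : ℤ} {R : ℤ → ℤ → Prop} {x : ℤ} (hx : x ≠ 0) (hm : m = x * s) (g : Good m R)
    (h : Inv s R) (i j k : ℤ) (hij : R i j) : R (i + s * k) (j + s * k) := by
  have pos : ∀ (n : ℕ) i j, R i j → R (i + s * n) (j + s * n) := by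
    intro n
    induction n with
    | zero => intro i j h; simpa using h
    | succ n ih =>
      intro i j hij
      have := h _ _ (ih i j hij)
      convert this using 1 <;> push_cast <;> ring
  have e := g.eqv
  have h1 := pos (k % x).toNat i j hij
  have h0 := Int.emod_nonneg k hx
  have hk := Int.emod_add_mul_ediv k x
  have hv : ((k % x).toNat : ℤ) = k % x := by simp [h0]
  rw [hv] at h1
  have h2 : ∀ l, R (l + s * (k % x)) (l + s * k) := by
    intro l
    have := g.mul (l + s * (k % x)) (k / x)
    convert this using 1
    rw [hm]; nth_rewrite 1 [← hk]; ring
  exact e.trans (e.symm (h2 i)) (e.trans h1 (h2 j))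

theorem rotInv_of_inv {m s x : ℕ} (hm : 0 < m) (hx : x ≠ 0) (hms : m = x * s)
    {R : ℤ → ℤ → Prop} (g : Good m R) (h : Inv s R) : RotInv m s (part m R) := by
  rintro _ ⟨i, rfl⟩
  have e := g.eqv
  refine ⟨rot m s i, ?_⟩
  have hri := rot_rel (s := s) g i
  ext j
  constructor
  · rintro ⟨l, hl, rfl⟩
    exact e.trans hri (e.trans (h _ _ hl) (e.symm (rot_rel g l)))
  · intro hj
    refine ⟨NCRed.cl m hm ((j.val : ℤ) - s), ?_, ?_⟩
    · have h1 : R ((i.val : ℤ) + s) j.val := e.trans (e.symm hri) hj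
      have h2 := Inv.mul (x := (x:ℤ)) (by exact_mod_cast hx) (by rw [hms]; push_cast; ring) g h
        _ _ (-1) h1
      simp only [mul_neg, mul_one, add_neg_cancel_right] at h2
      exact e.trans h2 (e.symm (g.cl hm _))
    · apply Fin.ext
      have h1 := cl_val m hm ((j.val : ℤ) - s)
      have h2 : ((rot m s (NCRed.cl m hm ((j.val : ℤ) - s))).val : ℤ) = j.val := by
        simp only [rot]
        push_cast
        rw [h1, Int.emod_add_emod, sub_add_cancel]
        exact Int.emod_eq_of_lt (by omega) (by have := j.2; omega)
      exact_mod_cast h2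

def redR (s : ℤ) (R : ℤ → ℤ → Prop) (i j : ℤ) : Prop := ∃ k, R i (j + s * k)

theorem redR_eqv {s m x : ℤ} {R : ℤ → ℤ → Prop} (hx : x ≠ 0) (hm : m = x * s) (g : Good m R)
    (h : Inv s R) : Equivalence (redR s R) := by
  refine ⟨fun i => ⟨0, by simpa using g.eqv.refl i⟩, ?_, ?_⟩
  · rintro i j ⟨k, hk⟩
    refine ⟨-k, ?_⟩
    have := Inv.mul hx hm g h _ _ (-k) hk
    rw [show j + s * k + s * -k = j by ring] at this
    exact g.eqv.symm this
  · rintro i j l ⟨k, hk⟩ ⟨k', hk'⟩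
    refine ⟨k' + k, ?_⟩
    have := Inv.mul hx hm g h _ _ k hk'
    rw [show l + s * k' + s * k = l + s * (k' + k) by ring] at this
    exact g.eqv.trans hk this

theorem redR_per {s m : ℤ} {R : ℤ → ℤ → Prop} (g : Good m R) (i : ℤ) : redR s R i (i + s) :=
  ⟨-1, by simpa using g.eqv.refl i⟩

theorem redR_of {s : ℤ} {R : ℤ → ℤ → Prop} {i j : ℤ} (h : R i j) : redR s R i j :=
  ⟨0, by simpa using h⟩

theorem redR_pos {s m x : ℤ} {R : ℤ → ℤ → Prop} (hx : 0 < x) (hm : m = x * s) (g : Good m R)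
    {i j : ℤ} (h : redR s R i j) : ∃ k, 0 ≤ k ∧ k < x ∧ R i (j + s * k) := by
  obtain ⟨k, hk⟩ := h
  refine ⟨k % x, Int.emod_nonneg _ hx.ne', Int.emod_lt_of_pos _ hx, ?_⟩
  refine g.eqv.trans hk (g.eqv.symm ?_)
  have := g.mul (j + s * (k % x)) (k / x)
  convert this using 1
  have hk := Int.emod_add_mul_ediv k x
  rw [hm]; nth_rewrite 1 [← hk]; ring

theorem Fmap_part {s h x : ℕ} (hs : 0 < s) (hx : x ≠ 0) (hh : h = x * s) {R : ℤ → ℤ → Prop}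
    (g : Good h R) (hi : Inv s R) : Fmap h s hs (part h R) = part s (redR s R) := by
  have hpos : 0 < h := by rw [hh]; positivity
  have hhZ : (h : ℤ) = x * s := by rw [hh]; push_cast; ring
  have E := redR_eqv (x := (x:ℤ)) (by exact_mod_cast hx) hhZ g hi
  have per := per_mul E (redR_per g)
  have img : ∀ i : Fin h, red h s hs '' {j : Fin h | R (i.val : ℤ) (j.val : ℤ)} =
      {y : Fin s | redR s R i.val y.val} := by
    intro i
    ext y
    constructor
    · rintro ⟨j, hj, rfl⟩
      refine ⟨(j.val : ℤ) / s, ?_⟩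
      simp only [red]
      push_cast
      rw [Int.emod_add_mul_ediv]
      exact hj
    · rintro ⟨k, hk⟩
      refine ⟨NCRed.cl h hpos (y.val + s * k), g.eqv.trans hk (g.eqv.symm (g.cl hpos _)), ?_⟩
      apply Fin.ext
      have h1 := cl_val h hpos (y.val + s * k)
      have h2 : ((red h s hs (NCRed.cl h hpos (y.val + s * k))).val : ℤ) = y.val := by
        simp only [red]
        push_cast
        rw [h1, hhZ, Int.emod_emod_of_dvd _ (Dvd.intro_left _ rfl)]
        rw [Int.add_mul_emod_self_left]
        exact Int.emod_eq_of_lt (by omega) (by have := y.2; omega)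
      exact_mod_cast h2
  ext B
  constructor
  · rintro ⟨_, ⟨i, rfl⟩, rfl⟩
    refine ⟨red h s hs i, ?_⟩
    simp only [img]
    have : redR s R ((red h s hs i).val : ℤ) i.val := by
      have := per ((red h s hs i).val : ℤ) ((i.val:ℤ) / s)
      simp only [red] at this ⊢
      push_cast at this ⊢
      rwa [Int.emod_add_mul_ediv] at this
    ext y
    exact ⟨fun hy => E.trans this hy, fun hy => E.trans (E.symm this) hy⟩
  · rintro ⟨i, rfl⟩
    have hlt : i.val < h := by
      have := i.2
      rw [hh]; nlinarith [Nat.pos_of_ne_zero hx]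
    exact ⟨_, ⟨⟨i.val, hlt⟩, rfl⟩, img ⟨i.val, hlt⟩⟩

section core
variable {s x : ℤ} {R : ℤ → ℤ → Prop}

theorem zero_all (hx : 2 ≤ x) (g : Good (x * s) R) (hi : Inv s R) {u : ℤ}
    (hu : R u (u + s)) (k : ℤ) : R u (u + s * k) := by
  have e := g.eqv
  have := per_mul (m := 1) (R := fun i j => R (u + s * i) (u + s * j))
    ⟨fun _ => e.refl _, fun h => e.symm h, fun h h' => e.trans h h'⟩
    (fun i => by
      have := Inv.mul (by omega) rfl g hi _ _ i hu
      rwa [show u + s + s * i = u + s * (i + 1) by ring] at this) 0 k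
  simpa using this

theorem zero_trans (g : Good (x * s) R) (hi : Inv s R) {u v : ℤ} (huv : R u v)
    (hu : R u (u + s)) : R v (v + s) :=
  g.eqv.trans (g.eqv.symm huv) (g.eqv.trans hu (hi _ _ huv))

theorem zero_red (hx : 2 ≤ x) (g : Good (x * s) R) (hi : Inv s R) {u v : ℤ}
    (hu : R u (u + s)) (huv : redR s R u v) : R u v := by
  obtain ⟨k, hk⟩ := huv
  have := zero_all hx g hi (zero_trans g hi hk hu) (-k)
  rw [show v + s * k + s * -k = v by ring] at this
  exact g.eqv.trans hk this

theorem short (hs : 0 < s) (hx : 2 ≤ x) (g : Good (x * s) R) (hi : Inv s R) {u v : ℤ}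
    (hu : ¬ R u (u + s)) (huv : R u v) :
    ∃ m, u - s < v + x * s * m ∧ v + x * s * m < u + s ∧ R u (v + x * s * m) := by
  have e := g.eqv
  have hm : 0 < x * s := by positivity
  have h2s : 2 * s ≤ x * s := by nlinarith
  have a1 := Int.emod_nonneg (v - u) hm.ne'
  have a2 := Int.emod_lt_of_pos (v - u) hm
  have a3 := Int.emod_add_mul_ediv (v - u) (x * s)
  have b1 : x * s * (-((v-u) / (x*s))) = - (x * s * ((v-u) / (x*s))) := by ring
  have b2 : x * s * (-((v-u) / (x*s)) - 1) = - (x * s * ((v-u) / (x*s))) - x * s := by ring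
  have r1 := e.trans huv (g.mul v (-((v-u) / (x*s))))
  have r2 := e.trans huv (g.mul v (-((v-u) / (x*s)) - 1))
  by_cases c1 : (v - u) % (x * s) < s
  · exact ⟨-((v-u) / (x*s)), by omega, by omega, r1⟩
  by_cases c2 : x * s - s < (v - u) % (x * s)
  · exact ⟨-((v-u) / (x*s)) - 1, by omega, by omega, r2⟩
  exfalso
  apply hu
  set v' := v + x * s * (-((v-u) / (x*s))) with hv'
  by_cases c3 : v' = u + s
  · rwa [c3] at r1
  by_cases c4 : v' = u + x * s - s
  · have r3 : R u (u - s) := by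
      have : v + x * s * (-((v-u) / (x*s)) - 1) = u - s := by omega
      rwa [this] at r2
    have := hi _ _ r3
    rw [sub_add_cancel] at this
    exact e.symm this
  exact g.nc u (u + s) v' (v' + s) (by omega) (by omega) (by omega) (by omega) r1 (hi _ _ r1)

theorem short' (hs : 0 < s) (hx : 2 ≤ x) (g : Good (x * s) R) (hi : Inv s R) {u v : ℤ}
    (hu : ¬ R u (u + s)) (h1 : u < v) (h2 : v < u + s) (huv : redR s R u v) :
    R u v ∨ R u (v - s) := by
  obtain ⟨k, hk⟩ := huv
  obtain ⟨m, a, b, c⟩ := short hs hx g hi hu hk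
  have e1 : v + s * k + x * s * m = v + s * (k + x * m) := by ring
  rw [e1] at a b c
  generalize k + x * m = t at *
  have t1 : t < 1 := by by_contra h; nlinarith
  have t2 : -2 < t := by by_contra h; nlinarith
  have : t = 0 ∨ t = -1 := by omega
  rcases this with rfl | rfl
  · left; simpa using c
  · right; simpa [sub_eq_add_neg] using c

theorem redR_good (hs : 0 < s) (hx : 2 ≤ x) (g : Good (x * s) R) (hi : Inv s R) :
    Good s (redR s R) := by
  have E := redR_eqv (by omega) rfl g hi
  have P := redR_per (s := s) g
  have e := g.eqv
  have h2s : 2 * s ≤ x * s := by nlinarith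
  refine ⟨E, P, ?_⟩
  intro a b c d hab hbc hcd hda hac hbd
  by_cases za : R a (a + s)
  · have rac := zero_red hx g hi za hac
    obtain ⟨k, k0, k1, hk⟩ := redR_pos (by omega) rfl g hbd
    have : s * k ≤ x * s - s := by nlinarith
    have : 0 ≤ s * k := by positivity
    exact redR_of (g.nc a b c (d + s * k) hab hbc (by omega) (by omega) rac hk)
  by_cases zb : R b (b + s)
  · have rbd := zero_red hx g hi zb hbd
    obtain ⟨k, k0, k1, hk⟩ := redR_pos (by omega) rfl g (E.trans (E.symm hac) (P a))
    have : s * k ≤ x * s - s := by nlinarith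
    have : 0 ≤ s * k := by positivity
    have := g.nc b c d (a + s + s * k) hbc hcd (by omega) (by omega) rbd hk
    exact E.trans hac (E.symm (redR_of this))
  rcases short' hs hx g hi za (by omega) (by omega) hac with h1 | h1 <;>
  rcases short' hs hx g hi zb (by omega) (by omega) hbd with h2 | h2
  · exact redR_of (g.nc a b c d hab hbc hcd (by omega) h1 h2)
  · have := g.nc (d - s) a b c (by omega) hab hbc (by omega) (e.symm h2) h1
    exact redR_of (e.trans (e.symm this) (e.symm h2))
  · have h3 := hi _ _ h1
    rw [sub_add_cancel] at h3
    have := g.nc b c d (a + s) hbc hcd (by omega) (by omega) h2 (e.symm h3)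
    exact E.trans hac (E.symm (redR_of this))
  · have := g.nc (c - s) (d - s) a b (by omega) (by omega) hab (by omega) (e.symm h1) (e.symm h2)
    exact redR_of (e.trans h1 (e.trans this (e.symm h2)))

def RS (s x : ℤ) (W : ℤ → ℤ → Prop) (z : ℤ → Prop) (p i j : ℤ) : Prop :=
  W i j ∧ (z i ∨ x ∣ (i - p) / s - (j - p) / s)

theorem sec_shift (hs : 0 < s) (p i k : ℤ) : (i + s * k - p) / s = (i - p) / s + k := by
  rw [show i + s * k - p = i - p + s * k by ring]
  exact Int.add_mul_ediv_left _ _ hs.ne'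

theorem sec_spec (hs : 0 < s) (p i : ℤ) :
    p + s * ((i - p) / s) ≤ i ∧ i < p + s * ((i - p) / s) + s := by
  have h1 := Int.emod_nonneg (i - p) hs.ne'
  have h2 := Int.emod_lt_of_pos (i - p) hs
  have h3 := Int.emod_add_mul_ediv (i - p) s
  omega

theorem sec_eq (hs : 0 < s) {p i k : ℤ} (h1 : p + s * k ≤ i) (h2 : i < p + s * k + s) :
    (i - p) / s = k := by
  have := sec_spec hs p i
  generalize (i - p) / s = t at *
  have : t < k + 1 := by by_contra h; nlinarith
  have : k < t + 1 := by by_contra h; nlinarith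
  omega

variable {W : ℤ → ℤ → Prop} {z : ℤ → Prop} {p : ℤ}

theorem RS_inv (hs : 0 < s) (gW : Good s W) (hz : ∀ i j, W i j → z i → z j) :
    Inv s (RS s x W z p) := by
  rintro i j ⟨h1, h2⟩
  have e := gW.eqv
  refine ⟨e.trans (e.symm (gW.per i)) (e.trans h1 (gW.per j)), ?_⟩
  rcases h2 with h2 | h2
  · left; exact hz _ _ (gW.per i) h2
  · right
    have a := sec_shift hs p i 1
    have b := sec_shift hs p j 1
    rw [mul_one] at a b
    rw [a, b]
    simpa using h2

theorem RS_red (hs : 0 < s) (gW : Good s W) : redR s (RS s x W z p) = W := by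
  have e := gW.eqv
  funext i j
  apply propext
  constructor
  · rintro ⟨k, h, _⟩
    exact e.trans h (e.symm (gW.mul j k))
  · intro h
    refine ⟨(i - p) / s - (j - p) / s, e.trans h (gW.mul _ _), Or.inr ?_⟩
    rw [sec_shift hs]
    simp

theorem RS_good (hs : 0 < s) (hx : 2 ≤ x) (gW : Good s W)
    (hz : (∀ i, ¬ z i) ∨ (∀ i, z i ↔ W p i)) : Good (x * s) (RS s x W z p) := by
  have e := gW.eqv
  have hzz : ∀ i j, W i j → z i → z j := by
    intro i j hij hi
    rcases hz with h | h
    · exact absurd hi (h i)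
    · rw [h] at hi ⊢; exact e.trans hi hij
  have E : Equivalence (RS s x W z p) := by
    refine ⟨fun i => ⟨e.refl i, Or.inr (by simp)⟩, ?_, ?_⟩
    · rintro i j ⟨h1, h2⟩
      refine ⟨e.symm h1, ?_⟩
      rcases h2 with h2 | h2
      · exact Or.inl (hzz _ _ h1 h2)
      · exact Or.inr (by rw [dvd_sub_comm]; exact h2)
    · rintro i j k ⟨h1, h2⟩ ⟨h3, h4⟩
      refine ⟨e.trans h1 h3, ?_⟩
      rcases h2 with h2 | h2
      · exact Or.inl h2
      rcases h4 with h4 | h4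
      · exact Or.inl (hzz _ _ (e.symm h1) h4)
      · right
        have := dvd_add h2 h4
        simpa using this
  have per : ∀ i, RS s x W z p i (i + x * s) := by
    intro i
    rw [mul_comm]
    refine ⟨gW.mul i x, Or.inr ?_⟩
    rw [sec_shift hs]
    simp
  have hm : 0 < x * s := by positivity
  refine ⟨E, per, nc_of_window hm E per p ?_⟩
  intro a b c d h0 hab hbc hcd hd hac hbd
  have secb : ∀ i, p ≤ i → i < p + x * s → 0 ≤ (i - p) / s ∧ (i - p) / s < x := by
    intro i h1 h2
    have := sec_spec hs p i
    generalize (i - p) / s = t at *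
    constructor
    · by_contra h; nlinarith
    · by_contra h; nlinarith
  have seceq : ∀ i j, p ≤ i → i < p + x * s → p ≤ j → j < p + x * s →
      x ∣ (i - p) / s - (j - p) / s → (i - p) / s = (j - p) / s := by
    intro i j h1 h2 h3 h4 h5
    have a1 := secb i h1 h2
    have a2 := secb j h3 h4
    have := Int.eq_zero_of_abs_lt_dvd h5 (by rw [abs_lt]; omega)
    omega
  have btw : ∀ i j k, i < j → j < k → (i - p) / s = (k - p) / s → (j - p) / s = (i - p) / s := by
    intro i j k h1 h2 h3
    have a1 := sec_spec hs p i
    have a2 := sec_spec hs p k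
    rw [← h3] at a2
    exact sec_eq hs (by omega) (by omega)
  obtain ⟨wac, oac⟩ := hac
  obtain ⟨wbd, obd⟩ := hbd
  have sp := sec_spec hs p
  by_cases za : z a
  · by_cases zb : z b
    · rcases hz with h | h
      · exact absurd za (h a)
      · exact ⟨e.trans (e.symm ((h a).1 za)) ((h b).1 zb), Or.inl za⟩
    · exfalso
      rcases hz with h | h
      · exact absurd za (h a)
      · apply zb
        have hbd' := seceq b d (by omega) (by omega) (by omega) (by omega) (obd.resolve_left zb)
        have s1 := sp b
        have s2 := sp d
        rw [← hbd'] at s2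
        have hp := gW.mul p ((b - p) / s)
        have hne : p + s * ((b - p) / s) ≠ b := by
          intro hh; apply zb; rw [h]; rwa [hh] at hp
        have := gW.nc (p + s * ((b - p) / s)) b c d (by omega) hbc hcd (by omega)
          (e.trans (e.symm hp) (e.trans ((h a).1 za) wac)) wbd
        rw [h]
        exact e.trans hp this
  · have hac' := seceq a c (by omega) (by omega) (by omega) (by omega) (oac.resolve_left za)
    have hb := btw a b c hab hbc hac'
    by_cases zb : z b
    · exfalso
      rcases hz with h | h
      · exact absurd zb (h b)
      · apply za
        have s1 := sp a
        have s2 := sp c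
        rw [← hac'] at s2
        have hp := gW.mul p ((a - p) / s)
        have hne : p + s * ((a - p) / s) ≠ a := by
          intro hh; apply za; rw [h]; rwa [hh] at hp
        have := gW.nc (p + s * ((a - p) / s)) a b c (by omega) hab hbc (by omega)
          (e.trans (e.symm hp) ((h b).1 zb)) wac
        rw [h]
        exact e.trans hp this
    · have hbd' := seceq b d (by omega) (by omega) (by omega) (by omega) (obd.resolve_left zb)
      refine ⟨?_, Or.inr (by rw [hb]; simp)⟩
      have s1 := sp a
      have s2 := sp d
      rw [← hbd', hb] at s2
      exact gW.nc a b c d hab hbc hcd (by omega) wac wbd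

theorem eq_RS (hs : 0 < s) (g : Good (x * s) R) (hW : redR s R = W)
    (hx : 2 ≤ x) (hi : Inv s R) (hz : ∀ i, z i → R i (i + s))
    (sub : ∀ i j, R i j → ¬ z i → x ∣ (i - p) / s - (j - p) / s) : R = RS s x W z p := by
  funext i j
  apply propext
  constructor
  · intro h
    refine ⟨by rw [← hW]; exact redR_of h, ?_⟩
    by_cases hzi : z i
    · exact Or.inl hzi
    · exact Or.inr (sub i j h hzi)
  · rintro ⟨h1, h2⟩
    rw [← hW] at h1
    by_cases hzi : z i
    · exact zero_red hx g hi (hz i hzi) h1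
    have h2 := h2.resolve_left hzi
    obtain ⟨k, hk⟩ := h1
    have h3 := sub _ _ hk hzi
    rw [sec_shift hs] at h3
    have h4 : x ∣ k := by
      have := dvd_sub h2 h3
      ring_nf at this
      exact this
    obtain ⟨t, rfl⟩ := h4
    have := g.mul j t
    rw [show j + x * s * t = j + s * (x * t) by ring] at this
    exact g.eqv.trans hk (g.eqv.symm this)

theorem short_trans (hs : 0 < s) (hx : 2 ≤ x) (g : Good (x * s) R) (hi : Inv s R)
    (hnz : ∀ u, ¬ R u (u + s)) {u v w : ℤ}
    (h1 : u < v) (h2 : v < u + s) (h3 : v < w) (h4 : w < v + s) (huv : R u v) (hvw : R v w) :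
    w < u + s := by
  have e := g.eqv
  have h2s : 2 * s ≤ x * s := by nlinarith
  by_contra h
  by_cases hw : w = u + s
  · subst hw
    exact hnz u (e.trans huv hvw)
  have a := Inv.mul (by omega) rfl g hi _ _ (-1) hvw
  simp only [mul_neg, mul_one, ← sub_eq_add_neg] at a
  have := g.nc (v - s) u (w - s) v (by omega) (by omega) (by omega) (by omega) a huv
  apply hnz (v - s)
  rw [sub_add_cancel]
  exact e.trans this huv

theorem classify (hs : 0 < s) (hx : 2 ≤ x) (g : Good (x * s) R) (hi : Inv s R)
    (hW : redR s R = W) :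
    (∃ q, 0 ≤ q ∧ q < s ∧ (¬ ∃ j, q < j ∧ j < s ∧ W q j) ∧ R = RS s x W (W q) q) ∨
    R = RS s x W (fun _ => False) 0 ∨
    (∃ q, 0 ≤ q ∧ q < s ∧ (∃ j, q < j ∧ j < s ∧ W q j) ∧
      R = RS s x W (fun _ => False) (q + 1)) := by
  have gW : Good s W := hW ▸ redR_good hs hx g hi
  have e := g.eqv
  have E := gW.eqv
  have h2s : 2 * s ≤ x * s := by nlinarith
  have hm : 0 < x * s := by positivity
  have toW : ∀ {i j}, R i j → W i j := fun h => by rw [← hW]; exact redR_of h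
  by_cases hZ : ∃ u, R u (u + s)
  · left
    obtain ⟨u, hu⟩ := hZ
    obtain ⟨q, ⟨q0, q1, hq⟩, hmax⟩ := Int.exists_greatest_of_bdd
      (P := fun q => 0 ≤ q ∧ q < s ∧ W u q) ⟨s, fun q h => by omega⟩
      ⟨u % s, Int.emod_nonneg _ hs.ne', Int.emod_lt_of_pos _ hs, E.symm (gW.emod u)⟩
    have hqz : R q (q + s) := zero_trans g hi (zero_red hx g hi hu (by rw [hW]; exact hq)) hu
    refine ⟨q, q0, q1, ?_, ?_⟩
    · rintro ⟨j, j0, j1, hj⟩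
      have := hmax j ⟨by omega, j1, E.trans hq hj⟩
      omega
    · refine eq_RS hs g hW hx hi ?_ ?_
      · intro i hqi
        exact zero_trans g hi (zero_red hx g hi hqz (by rw [hW]; exact hqi)) hqz
      · intro i j hij hz
        have s1 := sec_spec hs q i
        have hqk := zero_all hx g hi hqz ((i - q) / s)
        have hqk' := zero_all hx g hi hqz ((i - q) / s + 1)
        have wqk := toW hqk
        set k := (i - q) / s with hk
        have hne : q + s * k ≠ i := by intro h; apply hz; rwa [h] at wqk
        have a1 := Int.emod_nonneg (j - (q + s * k)) hm.ne'
        have a2 := Int.emod_lt_of_pos (j - (q + s * k)) hm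
        have a3 := Int.emod_add_mul_ediv (j - (q + s * k)) (x * s)
        set t := (j - (q + s * k)) / (x * s) with ht
        have hj' := g.mul j (-t)
        have b1 : x * s * (-t) = -(x * s * t) := by ring
        have b2 : s * (k + 1) = s * k + s := by ring
        rw [b2] at hqk'
        by_cases c : j + x * s * (-t) < q + s * k + s
        · have := sec_eq hs (p := q) (k := k) (i := j + x * s * (-t)) (by omega) (by omega)
          rw [show j + x * s * (-t) = j + s * (x * (-t)) by ring, sec_shift hs] at this
          rw [← this]
          simp
        · exfalso
          have hrij := e.trans hij hj'
          have hne2 : j + x * s * (-t) ≠ q + (s * k + s) := by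
            intro h
            rw [h] at hrij
            exact hz (E.symm (toW (e.trans hrij (e.symm hqk'))))
          have := g.nc (q + s * k) i (q + (s * k + s)) (j + x * s * (-t)) (by omega) (by omega)
            (by omega) (by omega) (e.trans (e.symm hqk) hqk') hrij
          exact hz (toW (e.trans hqk this))
  · right
    push Not at hZ
    -- a cut that no short chord crosses
    have cut : ∀ p, (∀ i j, i < p → p ≤ j → j < i + s → R i j → False) →
        R = RS s x W (fun _ => False) p := by
      intro p hp
      have hord : ∀ i j, i < j → j < i + s → R i j → (i - p) / s = (j - p) / s := by
        intro i j h1 h2 hij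
        have s1 := sec_spec hs p i
        set k := (i - p) / s with hk
        symm
        apply sec_eq hs (by omega)
        by_contra h
        have := Inv.mul (by omega) rfl g hi _ _ (-(k + 1)) hij
        have b : s * (-(k+1)) = - (s * k) - s := by ring
        exact hp (i + s * (-(k+1))) (j + s * (-(k+1))) (by omega) (by omega) (by omega) this
      refine eq_RS hs g hW hx hi (fun _ h => h.elim) ?_
      intro i j hij _
      obtain ⟨m, m1, m2, m3⟩ := short hs hx g hi (hZ i) hij
      have : (i - p) / s = (j + x * s * m - p) / s := by
        rcases lt_trichotomy i (j + x * s * m) with h | h | h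
        · exact hord _ _ h m2 m3
        · rw [← h]
        · exact (hord _ _ h (by omega) (e.symm m3)).symm
      rw [show j + x * s * m = j + s * (x * m) by ring, sec_shift hs] at this
      rw [this]; simp
    by_cases hc : ∃ j i, i < 0 ∧ 0 ≤ j ∧ j < i + s ∧ R i j
    · right
      obtain ⟨j, ⟨i, i0, j0, hji, hij⟩, hmax⟩ := Int.exists_greatest_of_bdd
        (P := fun j => ∃ i, i < 0 ∧ 0 ≤ j ∧ j < i + s ∧ R i j)
        ⟨s, by rintro j ⟨i, h⟩; omega⟩ hc
      refine ⟨j, j0, by omega, ⟨i + s, hji, by omega, E.trans (E.symm (toW hij)) (gW.per i)⟩, ?_⟩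
      apply cut
      intro i' j' h1 h2 h3 h4
      by_cases c1 : i' < 0
      · have := hmax j' ⟨i', c1, by omega, h3, h4⟩
        omega
      have hij' : R j j' := by
        by_cases c2 : i' = j
        · rwa [c2] at h4
        · have := g.nc i i' j j' (by omega) (by omega) (by omega) (by omega) hij h4
          exact e.trans (e.symm hij) (e.trans this h4)
      have := short_trans hs hx g hi hZ (u := i) (v := j) (w := j') (by omega) hji (by omega)
        (by omega) hij hij'
      have := hmax j' ⟨i, i0, by omega, this, e.trans hij hij'⟩
      omega
    · left
      apply cut
      intro i j h1 h2 h3 h4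
      exact hc ⟨j, i, h1, h2, h3, h4⟩

end core

open Classical in
noncomputable def Rof (s x : ℤ) (W : ℤ → ℤ → Prop) {n : ℕ} : Option (Fin n) → ℤ → ℤ → Prop
  | none => RS s x W (fun _ => False) 0
  | some q => if (∃ j : ℤ, (q.val : ℤ) < j ∧ j < s ∧ W q.val j)
      then RS s x W (fun _ => False) ((q.val : ℤ) + 1)
      else RS s x W (W q.val) q.val

theorem Rof_spec {s x : ℤ} {W : ℤ → ℤ → Prop} {n : ℕ} (hs : 0 < s) (hx : 2 ≤ x)
    (gW : Good s W) (o : Option (Fin n)) :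
    Good (x * s) (Rof s x W o) ∧ Inv s (Rof s x W o) ∧ redR s (Rof s x W o) = W := by
  have aux : ∀ p, Good (x * s) (RS s x W (fun _ => False) p) ∧
      Inv s (RS s x W (fun _ => False) p) ∧ redR s (RS s x W (fun _ => False) p) = W :=
    fun p => ⟨RS_good hs hx gW (Or.inl (by simp)), RS_inv hs gW (by simp), RS_red hs gW⟩
  rcases o with _ | q
  · exact aux 0
  · simp only [Rof]
    split_ifs
    · exact aux _
    · exact ⟨RS_good hs hx gW (Or.inr (by simp)),
        RS_inv hs gW (fun i j h h' => gW.eqv.trans h' h), RS_red hs gW⟩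

/-- No element of a `False`-type partition is related to its shift. -/
theorem RS_false_nz {s x : ℤ} {W : ℤ → ℤ → Prop} (hs : 0 < s) (hx : 2 ≤ x) (p u : ℤ) :
    ¬ RS s x W (fun _ => False) p u (u + s) := by
  rintro ⟨_, h | h⟩
  · exact h
  · have := sec_shift hs p u 1
    rw [mul_one] at this
    rw [this] at h
    have h2 : x ∣ 1 := by
      rw [sub_add_cancel_left] at h; exact (dvd_neg.mp h)
    have := Int.le_of_dvd (by norm_num) h2
    omega

theorem RS_cut_ne {s x : ℤ} {W : ℤ → ℤ → Prop} (hs : 0 < s) (hx : 2 ≤ x) (gW : Good s W)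
    {p q : ℤ} (h0 : 0 ≤ p) (hpq : p ≤ q) (hq : ∃ j, q < j ∧ j < s ∧ W q j) :
    RS s x W (fun _ => False) p ≠ RS s x W (fun _ => False) (q + 1) := by
  intro h
  obtain ⟨j, j1, j2, hj⟩ := hq
  have h1 : RS s x W (fun _ => False) (q + 1) j (q + s) := by
    refine ⟨gW.eqv.trans (gW.eqv.symm hj) (gW.per q), Or.inr ?_⟩
    rw [sec_eq hs (k := 0) (by omega) (by omega), sec_eq hs (k := 0) (by omega) (by omega)]
    simp
  rw [← h] at h1
  have h2 := h1.2.resolve_left (fun h => h)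
  rw [sec_eq hs (k := 0) (by omega) (by omega), sec_eq hs (k := 1) (by omega) (by omega)] at h2
  have h3 : x ∣ 1 := by
    rw [← dvd_neg]; simpa using h2
  have := Int.le_of_dvd (by norm_num) h3
  omega

theorem Rof_inj {s x : ℤ} {W : ℤ → ℤ → Prop} {n : ℕ} (hn : (n : ℤ) = s) (hs : 0 < s) (hx : 2 ≤ x)
    (gW : Good s W) : Function.Injective (Rof s x W (n := n)) := by
  have nz : ∀ p q, RS s x W (fun _ => False) p ≠ RS s x W (W q) q := by
    intro p q h
    have h1 : RS s x W (W q) q q (q + s) := ⟨gW.per q, Or.inl (gW.eqv.refl q)⟩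
    rw [← h] at h1
    exact RS_false_nz hs hx _ _ h1
  intro o o' h
  rcases o with _ | q <;> rcases o' with _ | q'
  · rfl
  · exfalso
    simp only [Rof] at h
    split_ifs at h with c
    · exact RS_cut_ne hs hx gW (le_refl 0) (by omega) c h
    · exact nz _ _ h
  · exfalso
    simp only [Rof] at h
    split_ifs at h with c
    · exact RS_cut_ne hs hx gW (le_refl 0) (by omega) c h.symm
    · exact nz _ _ h.symm
  · simp only [Rof] at h
    congr 1
    apply Fin.ext
    split_ifs at h with c c' c'
    · rcases lt_trichotomy q.val q'.val with l | l | l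
      · exact absurd h (RS_cut_ne hs hx gW (by omega) (by omega) c')
      · exact l
      · exact absurd h.symm (RS_cut_ne hs hx gW (by omega) (by omega) c)
    · exact absurd h (nz _ _)
    · exact absurd h.symm (nz _ _)
    · have h1 : RS s x W (W q.val) q.val q.val (q.val + s) :=
        ⟨gW.per _, Or.inl (gW.eqv.refl _)⟩
      rw [h] at h1
      have hw : W q'.val q.val := by
        by_contra hw
        have h2 := h1.2.resolve_left hw
        have := sec_shift hs (q'.val : ℤ) q.val 1
        rw [mul_one] at this
        rw [this] at h2
        have h3 : x ∣ 1 := by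
          rw [sub_add_cancel_left] at h2; exact (dvd_neg.mp h2)
        have := Int.le_of_dvd (by norm_num) h3
        omega
      have b1 := q.2
      have b2 := q'.2
      rcases lt_trichotomy q.val q'.val with l | l | l
      · exact absurd ⟨(q'.val : ℤ), by omega, by omega, gW.eqv.symm hw⟩ c
      · exact l
      · exact absurd ⟨(q.val : ℤ), by omega, by omega, hw⟩ c'

theorem fiber_card (s x h : ℕ) (hs : 0 < s) (hx : 2 ≤ x) (hh : h = x * s) :
    ∀ w ∈ NCA s,
      Nat.card {π : Set (Set (Fin h)) // π ∈ NCA h ∧ RotInv h s π ∧ Fmap h s hs π = w}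
        = s + 1 := by
  intro w hw
  obtain ⟨W, gW, rfl⟩ := exists_rel hs hw
  have hpos : 0 < h := by rw [hh]; positivity
  have hhZ : (h : ℤ) = x * s := by rw [hh]; push_cast; ring
  have hsZ : (0 : ℤ) < s := by exact_mod_cast hs
  have hxZ : (2 : ℤ) ≤ x := by exact_mod_cast hx
  have hx0 : x ≠ 0 := by omega
  have sp := fun o : Option (Fin s) => Rof_spec hsZ hxZ gW o
  rw [← hhZ] at sp
  let f : Option (Fin s) →
      {π : Set (Set (Fin h)) // π ∈ NCA h ∧ RotInv h s π ∧ Fmap h s hs π = part s W} :=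
    fun o => ⟨part h (Rof s x W o), part_mem (sp o).1,
      rotInv_of_inv hpos hx0 hh (sp o).1 (sp o).2.1, by
        rw [Fmap_part hs hx0 hh (sp o).1 (sp o).2.1, (sp o).2.2]⟩
  have hf : Function.Bijective f := by
    constructor
    · intro o o' ho
      have : part h (Rof s x W o) = part h (Rof s x W o') := congrArg Subtype.val ho
      exact Rof_inj rfl hsZ hxZ gW (part_inj hpos (sp o).1 (sp o').1 this)
    · rintro ⟨π, h1, h2, h3⟩
      obtain ⟨R, g, rfl⟩ := exists_rel hpos h1
      have hi := inv_of_rotInv hpos g h2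
      rw [Fmap_part hs hx0 hh g hi] at h3
      have g' := g
      rw [hhZ] at g'
      have hW := part_inj hs (redR_good hsZ hxZ g' hi) gW h3
      rcases classify hsZ hxZ g' hi hW with ⟨q, q0, q1, hq, rfl⟩ | rfl | ⟨q, q0, q1, hq, rfl⟩
      · lift q to ℕ using q0
        refine ⟨some ⟨q, by omega⟩, Subtype.ext ?_⟩
        simp only [f, Rof, if_neg hq]
      · exact ⟨none, Subtype.ext rfl⟩
      · lift q to ℕ using q0
        refine ⟨some ⟨q, by omega⟩, Subtype.ext ?_⟩
        simp only [f, Rof, if_pos hq]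
  rw [← Nat.card_congr (Equiv.ofBijective f hf)]
  simp

end NCRed

/-- Let `s ≥ 1`, `x ≥ 2` and `h = x·s`. For every `ρ_s`-invariant `π ∈ NC^A(h)`, the
collection `F(π)` of images of the blocks of `π` under the reduction map `i ↦ i mod s` is a
noncrossing partition of `{0,…,s-1}`; the resulting map `F` onto `NC^A(s)` is surjective,
and every fiber has exactly `s+1` elements. -/
theorem reduction_map_wellDefined_surjective_fibers
    (s x h : ℕ) (hs : 0 < s) (hx : 2 ≤ x) (hh : h = x * s) :
    (∀ π ∈ NCA h, RotInv h s π → Fmap h s hs π ∈ NCA s) ∧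
    Set.SurjOn (Fmap h s hs) {π | π ∈ NCA h ∧ RotInv h s π} (NCA s) ∧
    (∀ w ∈ NCA s,
      Nat.card {π : Set (Set (Fin h)) // π ∈ NCA h ∧ RotInv h s π ∧ Fmap h s hs π = w}
        = s + 1) := by
  refine ⟨?_, ?_, NCRed.fiber_card s x h hs hx hh⟩
  · intro π hπ hr
    have hpos : 0 < h := by rw [hh]; positivity
    have hhZ : (h : ℤ) = x * s := by rw [hh]; push_cast; ring
    obtain ⟨R, g, rfl⟩ := NCRed.exists_rel hpos hπ
    have hi := NCRed.inv_of_rotInv hpos g hr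
    rw [NCRed.Fmap_part hs (by omega) hh g hi]
    rw [hhZ] at g
    exact NCRed.part_mem
      (NCRed.redR_good (by exact_mod_cast hs) (by exact_mod_cast hx) g hi)
  · intro w hw
    have hc := NCRed.fiber_card s x h hs hx hh w hw
    have : Nat.card {π : Set (Set (Fin h)) //
        π ∈ NCA h ∧ RotInv h s π ∧ Fmap h s hs π = w} ≠ 0 := by omega
    obtain ⟨⟨π, h1, h2, h3⟩⟩ := (Nat.card_ne_zero.mp this).1
    exact ⟨π, ⟨h1, h2⟩, h3⟩
end

section
/- Let s ≥ 1 and x ≥ 2 be integers and set h = x·s. Let π ∈ NC^A(h) be invariant under ρ_s. Then: (i) at most one block B of π satisfies ρ_s(B) = B; and (ii) every block B of π either satisfies ρ_s(B) = B, or the x sets B, ρ_s(B), ρ_s²(B), …, ρ_s^{x−1}(B) are pairwise disjoint blocks of π. -/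
lemma rot_iterate (m t k : ℕ) (i : Fin m) : ((rot m t)^[k] i).val = (i.val + k * t) % m := by
  induction k with
  | zero => simp [Nat.mod_eq_of_lt i.isLt]
  | succ k ih =>
    rw [Function.iterate_succ_apply']
    simp only [rot, ih, Nat.mod_add_mod]
    congr 1; ring

lemma rot_iterate_eq (m t k : ℕ) : (rot m t)^[k] = rot m (k * t) := by
  funext i
  apply Fin.ext
  rw [rot_iterate]
  rfl

lemma image_iter {α : Type*} (f : α → α) (k : ℕ) (B : Set α) :
    (fun S : Set α => f '' S)^[k] B = f^[k] '' B := by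
  rw [← Set.image_iterate_eq]

lemma residue_mem (s x h : ℕ) (hs : 1 ≤ s) (hx : 2 ≤ x) (hh : h = x * s) (B : Set (Fin h))
    (hB : rot h s '' B = B) (a : Fin h) (ha : a ∈ B) :
    ∃ r < s, ∃ (h1 : r < h) (h2 : r + s < h), (⟨r, h1⟩ : Fin h) ∈ B ∧ (⟨r + s, h2⟩ : Fin h) ∈ B := by
  have hr : a.val % s < s := Nat.mod_lt _ hs
  have h2s : 2 * s ≤ h := by rw [hh]; exact Nat.mul_le_mul_right _ hx
  have hq : a.val / s < x := by
    rw [Nat.div_lt_iff_lt_mul hs, ← hh]; exact a.isLt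
  have hfix : ∀ b ∈ B, rot h s b ∈ B := fun b hb => hB ▸ Set.mem_image_of_mem _ hb
  have hit : ∀ k, (rot h s)^[k] a ∈ B := by
    intro k
    induction k with
    | zero => exact ha
    | succ k ih => rw [Function.iterate_succ_apply']; exact hfix _ ih
  have h1 : (⟨a.val % s, by omega⟩ : Fin h) ∈ B := by
    have e : (rot h s)^[x - a.val / s] a = ⟨a.val % s, by omega⟩ := by
      apply Fin.ext
      rw [rot_iterate]
      have e1 : a.val + (x - a.val / s) * s = a.val % s + h := by
        obtain ⟨y, hy⟩ := Nat.exists_eq_add_of_lt hq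
        have e2 : x - a.val / s = y + 1 := by omega
        have e3 := Nat.mod_add_div a.val s
        have e4 : h = (a.val / s + y + 1) * s := by rw [← hy]; exact hh
        rw [e2]
        nlinarith
      rw [e1, Nat.add_mod_right, Nat.mod_eq_of_lt (by omega)]
    rw [← e]; exact hit _
  refine ⟨a.val % s, hr, by omega, by omega, h1, ?_⟩
  have := hfix _ h1
  convert this using 1
  apply Fin.ext
  have h3 : a.val % s + s < h := by omega
  exact (Nat.mod_eq_of_lt h3).symm

lemma fixed_unique (s x h : ℕ) (hs : 1 ≤ s) (hx : 2 ≤ x) (hh : h = x * s)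
    (π : Set (Set (Fin h))) (hπ : π ∈ NCA h) :
    ∀ B ∈ π, ∀ B' ∈ π, rot h s '' B = B → rot h s '' B' = B' → B = B' := by
  intro B hB B' hB' fB fB'
  obtain ⟨a, ha⟩ := Setoid.nonempty_of_mem_partition hπ.1 hB
  obtain ⟨b, hb⟩ := Setoid.nonempty_of_mem_partition hπ.1 hB'
  obtain ⟨r, hr, r1, r2, hr1, hr2⟩ := residue_mem s x h hs hx hh B fB a ha
  obtain ⟨t, ht, t1, t2, ht1, ht2⟩ := residue_mem s x h hs hx hh B' fB' b hb
  by_contra hne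
  rcases lt_trichotomy r t with hlt | heq | hlt
  · exact hπ.2 ⟨r, r1⟩ ⟨t, t1⟩ ⟨r + s, r2⟩ ⟨t + s, t2⟩ (by simpa using hlt)
      (by simp; omega) (by simpa using hlt) B hB B' hB' hne hr1 hr2 ht1 ht2
  · subst heq
    exact hne ((hπ.1.2 ⟨r, r1⟩).unique ⟨hB, hr1⟩ ⟨hB', ht1⟩)
  · exact hπ.2 ⟨t, t1⟩ ⟨r, r1⟩ ⟨t + s, t2⟩ ⟨r + s, r2⟩ (by simpa using hlt)
      (by simp; omega) (by simpa using hlt) B' hB' B hB (Ne.symm hne) ht1 ht2 hr1 hr2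

lemma rot_injective (m t : ℕ) : Function.Injective (rot m t) := by
  intro a b hab
  have h1 : (a.val + t) % m = (b.val + t) % m := congrArg Fin.val hab
  have h2 : a.val ≡ b.val [MOD m] := Nat.ModEq.add_right_cancel' t h1
  exact Fin.ext (h2.eq_of_lt_of_lt a.isLt b.isLt)

/-- Let `s ≥ 1`, `x ≥ 2`, `h = x·s` and let `π ∈ NC^A(h)` be `ρ_s`-invariant. Then
(i) at most one block `B` of `π` satisfies `ρ_s(B) = B`, and (ii) every block `B` of `π`
either satisfies `ρ_s(B) = B`, or the `x` sets `B, ρ_s(B), …, ρ_s^{x-1}(B)` are pairwise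
disjoint blocks of `π`. -/
theorem blocks_of_invariant_noncrossing_partition
    (s x h : ℕ) (hs : 1 ≤ s) (hx : 2 ≤ x) (hh : h = x * s)
    (π : Set (Set (Fin h))) (hπ : π ∈ NCA h) (hinv : RotInv h s π) :
    (∀ B ∈ π, ∀ B' ∈ π, rot h s '' B = B → rot h s '' B' = B' → B = B') ∧
    (∀ B ∈ π, rot h s '' B = B ∨
      ((∀ k < x, (rot h s)^[k] '' B ∈ π) ∧
        ∀ k < x, ∀ l < x, k ≠ l → Disjoint ((rot h s)^[k] '' B) ((rot h s)^[l] '' B))) := by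
  refine ⟨fixed_unique s x h hs hx hh π hπ, ?_⟩
  intro B hB
  have hmem : ∀ k, (rot h s)^[k] '' B ∈ π := by
    intro k
    induction k with
    | zero => simpa using hB
    | succ k ih =>
      rw [Function.iterate_succ', Set.image_comp]
      exact hinv _ ih
  have key : ∀ k l, k < l → l < x →
      ¬ Disjoint ((rot h s)^[k] '' B) ((rot h s)^[l] '' B) → rot h s '' B = B := by
    intro k l hkl hl hd
    have heq : (rot h s)^[k] '' B = (rot h s)^[l] '' B := by
      obtain ⟨z, hz1, hz2⟩ := Set.not_disjoint_iff.1 hd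
      exact (hπ.1.2 z).unique ⟨hmem k, hz1⟩ ⟨hmem l, hz2⟩
    have hper : (rot h s)^[l - k] '' B = B := by
      have e : l = k + (l - k) := by omega
      rw [e, Function.iterate_add, Set.image_comp] at heq
      exact (((rot_injective h s).iterate k).image_injective heq).symm
    have hperx : (rot h s)^[x] '' B = B := by
      have : (rot h s)^[x] = id := by
        funext i
        apply Fin.ext
        rw [rot_iterate, ← hh, Nat.add_mod_right, Nat.mod_eq_of_lt i.isLt, id]
      rw [this, Set.image_id]
    have p1 : Function.IsPeriodicPt (fun S : Set (Fin h) => rot h s '' S) (l - k) B := by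
      rw [Function.IsPeriodicPt, Function.IsFixedPt, image_iter]; exact hper
    have p2 : Function.IsPeriodicPt (fun S : Set (Fin h) => rot h s '' S) x B := by
      rw [Function.IsPeriodicPt, Function.IsFixedPt, image_iter]; exact hperx
    have p3 := p1.gcd p2
    rw [Function.IsPeriodicPt, Function.IsFixedPt, image_iter] at p3
    obtain ⟨y, hy⟩ := Nat.gcd_dvd_right (l - k) x
    have hgpos : 0 < Nat.gcd (l - k) x := Nat.gcd_pos_of_pos_right _ (by omega)
    have hgle : Nat.gcd (l - k) x ≤ l - k := Nat.gcd_le_left _ (by omega)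
    generalize Nat.gcd (l - k) x = g at *
    have hy2 : 2 ≤ y := by
      by_contra hc
      have : y ≤ 1 := by omega
      have : g * y ≤ g * 1 := Nat.mul_le_mul_left _ this
      omega
    have p4 : rot h (g * s) '' (rot h s '' B) = rot h s '' B := by
      rw [← rot_iterate_eq, ← Set.image_comp, ← Function.iterate_succ, Function.iterate_succ',
        Set.image_comp, p3]
    rw [rot_iterate_eq] at p3
    exact fixed_unique (g * s) y h (Nat.mul_pos hgpos hs) hy2 (by rw [hh, hy]; ring) π hπ _
      (hinv B hB) B hB p4 p3
  by_cases hf : rot h s '' B = B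
  · exact Or.inl hf
  · refine Or.inr ⟨fun k _ => hmem k, ?_⟩
    intro k hk l hl hkl
    by_contra hd
    rcases lt_or_gt_of_ne hkl with h1 | h1
    · exact hf (key k l h1 hl hd)
    · exact hf (key l k h1 hk (fun hh => hd hh.symm))
end

section
/- Let k ≥ 2 and m = 2k. The number of elements of NC^A(m) that are invariant under the rotation ρ_k and contain at least one block of the form {i, i+k} with 0 ≤ i ≤ k−1 equals C(2(k−1), k−1). -/
/-- Noncrossing equivalence relations on ℕ supported in `[a,b)`. -/
structure IsNC (a b : ℕ) (r : ℕ → ℕ → Prop) : Prop where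
  rfl' : ∀ x, r x x
  symm' : ∀ x y, r x y → r y x
  trans' : ∀ x y z, r x y → r y z → r x z
  supp : ∀ x y, r x y → x = y ∨ (a ≤ x ∧ x < b ∧ a ≤ y ∧ y < b)
  nc : ∀ w x y z, w < x → x < y → y < z → r w y → r x z → r w x

theorem IsNC.congr_right {a b c : ℕ} {r : ℕ → ℕ → Prop} (h : b = c) (hr : IsNC a b r) :
    IsNC a c r := h ▸ hr

def phi (a j x : ℕ) : ℕ := if x = j then a else x

def glue (a j : ℕ) (s t : ℕ → ℕ → Prop) (x y : ℕ) : Prop :=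
  s (phi a j x) (phi a j y) ∨ t x y

def restr (a b : ℕ) (r : ℕ → ℕ → Prop) (x y : ℕ) : Prop :=
  x = y ∨ (a ≤ x ∧ x < b ∧ a ≤ y ∧ y < b ∧ r x y)

theorem restr_isNC {a b c d : ℕ} {r : ℕ → ℕ → Prop} (h : IsNC a b r) : IsNC c d (restr c d r) := by
  obtain ⟨h1, h2, h3, h4, h5⟩ := h
  constructor <;> unfold restr
  · grind
  · grind
  · grind
  · grind
  · intro w x y z _ _ _ h6 h7
    have := h5 w x y z
    grind

theorem glue_isNC {a b j : ℕ} {s t : ℕ → ℕ → Prop} (haj : a ≤ j) (hjb : j < b)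
    (hs : IsNC a j s) (ht : IsNC (j+1) b t) : IsNC a b (glue a j s t) := by
  obtain ⟨h1, h2, h3, h4, h5⟩ := hs
  obtain ⟨k1, k2, k3, k4, k5⟩ := ht
  constructor <;> unfold glue
  · grind
  · grind
  · intro x y z h6 h7
    have e1 := h4 (phi a j x) (phi a j y)
    have e2 := h4 (phi a j y) (phi a j z)
    have e3 := k4 x y
    have e4 := k4 y z
    rcases h6 with h6 | h6 <;> rcases h7 with h7 | h7
    · left; exact h3 _ _ _ h6 h7
    · have := e1 h6
      have := e4 h7
      grind [phi]
    · have := e2 h7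
      have := e3 h6
      grind [phi]
    · right; exact k3 _ _ _ h6 h7
  · intro x y h
    have e1 := h4 (phi a j x) (phi a j y)
    have e3 := k4 x y
    grind [phi]
  · intro w x y z hw hx hy h6 h7
    have e1 := h4 (phi a j w) (phi a j y)
    have e2 := h4 (phi a j x) (phi a j z)
    have e3 := k4 w y
    have e4 := k4 x z
    rcases h6 with h6 | h6 <;> rcases h7 with h7 | h7
    · left
      have e1 := e1 h6
      have e2 := e2 h7
      have f1 := h5 w x y z hw hx hy
      have f2 := h5 a w x y
      have hz : z ≤ j := by
        clear f1 f2 h1 h2 h3 h4 h5 k1 k2 k3 k4 k5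
        unfold phi at e2; split_ifs at e2 <;> omega
      have pw : phi a j w = w := if_neg (by omega)
      have px : phi a j x = x := if_neg (by omega)
      have py : phi a j y = y := if_neg (by omega)
      rw [pw, py] at h6 e1
      rw [px] at h7 e2
      rw [pw, px]
      by_cases hzj : z = j
      · have pz : phi a j z = a := if_pos hzj
        rw [pz] at h7 e2
        have h8 := h2 _ _ h7
        rcases Nat.lt_or_ge a w with haw | haw
        · have h9 := f2 haw hw hx h8 h6
          exact h3 _ _ _ (h2 _ _ h9) h8
        · have : w = a := by omega
          rw [this]; exact h8
      · have pz : phi a j z = z := if_neg hzj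
        rw [pz] at h7
        exact f1 h6 h7
    · have e1 := e1 h6
      have e4 := e4 h7
      grind [phi]
    · have e1 := e2 h7
      have e4 := e3 h6
      grind [phi]
    · right; exact k5 _ _ _ _ hw hx hy h6 h7

theorem glue_max {a b j : ℕ} {s t : ℕ → ℕ → Prop} (haj : a ≤ j)
    (hs : IsNC a j s) (ht : IsNC (j+1) b t) :
    glue a j s t a j ∧ ∀ x, glue a j s t a x → x ≤ j := by
  obtain ⟨h1, h2, h3, h4, h5⟩ := hs
  obtain ⟨k1, k2, k3, k4, k5⟩ := ht
  constructor
  · left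
    have : phi a j a = phi a j j := by grind [phi]
    rw [this]; apply h1
  · intro x hx
    rcases hx with hx | hx
    · have := h4 _ _ hx
      grind [phi]
    · have := k4 _ _ hx
      grind

theorem glue_left {a b j : ℕ} {s t : ℕ → ℕ → Prop}
    (hs : IsNC a j s) (ht : IsNC (j+1) b t) : restr a j (glue a j s t) = s := by
  obtain ⟨h1, h2, h3, h4, h5⟩ := hs
  obtain ⟨k1, k2, k3, k4, k5⟩ := ht
  funext x y
  have e1 := h4 x y
  have e3 := k4 x y
  apply propext
  unfold restr glue phi
  grind

theorem glue_right {a b j : ℕ} {s t : ℕ → ℕ → Prop} (haj : a ≤ j)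
    (hs : IsNC a j s) (ht : IsNC (j+1) b t) : restr (j+1) b (glue a j s t) = t := by
  obtain ⟨h1, h2, h3, h4, h5⟩ := hs
  obtain ⟨k1, k2, k3, k4, k5⟩ := ht
  funext x y
  have e1 := h4 x y
  have e3 := k4 x y
  apply propext
  unfold restr glue phi
  grind

theorem glue_restr {a b j : ℕ} {r : ℕ → ℕ → Prop} (haj : a ≤ j)
    (h : IsNC a b r) (h1 : r a j) (h2 : ∀ x, r a x → x ≤ j) :
    glue a j (restr a j r) (restr (j+1) b r) = r := by
  obtain ⟨k1, k2, k3, k4, k5⟩ := h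
  have cross : ∀ x y, x ≤ j → j < y → ¬ r x y := by
    intro x y hx hy hr
    have e := k4 x y hr
    have h2y := h2 y
    have e2 := k5 a x j y
    have e3 := k3 a x y
    have e4 := k3 a j y
    by_cases c1 : x = a
    · grind
    by_cases c2 : x = j
    · grind
    grind
  funext x y
  apply propext
  have c1 := cross x y
  have c2 := cross y x
  have e := k4 x y
  have e0 := k2 x y
  have e1 := k3 x j a
  have e2 := k3 x a j
  have e3 := k3 j a y
  have e4 := k3 a j y
  have e5 := k2 a j
  unfold glue restr phi
  constructor
  · grind
  · grind

theorem card_NC (n : ℕ) : ∀ a, Finite {r // IsNC a (a+n) r} ∧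
    Nat.card {r // IsNC a (a+n) r} = catalan n := by
  induction n using Nat.strong_induction_on with
  | _ n ih =>
  intro a
  rcases n with _ | n
  · have hu : ∀ r, IsNC a (a+0) r → r = (fun x y => x = y) := by
      intro r hr
      funext x y
      have := hr.supp x y
      have := hr.rfl' x
      apply propext
      grind
    have : Unique {r // IsNC a (a+0) r} :=
      { default := ⟨fun x y => x = y, by constructor <;> grind⟩
        uniq := fun r => Subtype.ext ((hu _ r.2)) }
    exact ⟨inferInstance, by simp⟩
  · let X := Σ j : Fin (n+1), {r // IsNC a (a+j) r} × {r // IsNC (a+j+1) (a+j+1+(n-j)) r}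
    have key : ∀ j : Fin (n+1), a + j + 1 + (n - j) = a + (n+1) := by intro j; omega
    let F : X → {r // IsNC a (a+(n+1)) r} := fun p =>
      ⟨glue a (a+p.1) p.2.1.1 p.2.2.1, glue_isNC (by omega) (by omega) p.2.1.2
        (IsNC.congr_right (key p.1) p.2.2.2)⟩
    have hF : Function.Bijective F := by
      constructor
      · rintro ⟨j, ⟨s, hs⟩, ⟨t, ht⟩⟩ ⟨j', ⟨s', hs'⟩, ⟨t', ht'⟩⟩ heq
        have heq : glue a (a+j) s t = glue a (a+j') s' t' := congrArg Subtype.val heq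
        have m1 := glue_max (by omega) hs ht
        have m2 := glue_max (by omega) hs' ht'
        have : j = j' := by
          rw [heq] at m1
          have := m1.2 _ m2.1
          have := m2.2 _ m1.1
          omega
        subst this
        have l1 := glue_left hs ht
        have l2 := glue_left hs' ht'
        have r1 := glue_right (by omega) hs ht
        have r2 := glue_right (by omega) hs' ht'
        rw [heq] at l1 r1
        have : s = s' := l1.symm.trans l2
        subst this
        have : t = t' := r1.symm.trans r2
        subst this
        rfl
      · rintro ⟨r, hr⟩
        classical
        have hex : ∃ j, a ≤ j ∧ j < a+(n+1) ∧ r a j ∧ ∀ x, r a x → x ≤ j := by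
          have hP : r a a := hr.rfl' a
          refine ⟨Nat.findGreatest (r a) (a+n), ?_, ?_, ?_, ?_⟩
          · exact Nat.le_findGreatest (by omega) hP
          · have := Nat.findGreatest_le (P := r a) (a+n); omega
          · exact Nat.findGreatest_spec (P := r a) (m := a) (by omega) hP
          · intro x hx
            have := hr.supp _ _ hx
            exact Nat.le_findGreatest (by omega) hx
        obtain ⟨j, h1, h2, h3, h4⟩ := hex
        obtain ⟨i, rfl⟩ := Nat.exists_eq_add_of_le h1
        refine ⟨⟨⟨i, by omega⟩, ⟨restr a (a+i) r, restr_isNC hr⟩,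
          ⟨restr (a+i+1) (a+i+1+(n-i)) r, restr_isNC hr⟩⟩, ?_⟩
        apply Subtype.ext
        have := glue_restr h1 hr h3 h4
        have e : a+i+1+(n-i) = a+(n+1) := by omega
        simp only [F, e]
        exact this
    have fin1 : ∀ j : Fin (n+1), Finite {r // IsNC a (a+j) r} := fun j => (ih j (by omega) a).1
    have fin2 : ∀ j : Fin (n+1), Finite {r // IsNC (a+j+1) (a+j+1+(n-j)) r} :=
      fun j => (ih (n-j) (by omega) (a+j+1)).1
    refine ⟨Finite.of_surjective F hF.2, ?_⟩
    rw [← Nat.card_congr (Equiv.ofBijective F hF), Nat.card_sigma, catalan_succ]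
    refine Finset.sum_congr rfl fun j _ => ?_
    rw [Nat.card_prod, (ih j (by omega) a).2, (ih (n-j) (by omega) (a+j+1)).2]

def sig (k x : ℕ) : ℕ := if x < k then x + k else x - k

/-- relations on `[0,2k)` invariant under the half turn, with a block `{i,i+k}` -/
structure IsMain (k i : ℕ) (T : ℕ → ℕ → Prop) : Prop where
  hi : i < k
  rfl' : ∀ x, x < 2 * k → T x x
  symm' : ∀ x y, T x y → T y x
  trans' : ∀ x y z, T x y → T y z → T x z
  supp : ∀ x y, T x y → x < 2 * k ∧ y < 2 * k
  nc : ∀ w x y z, w < x → x < y → y < z → T w y → T x z → T w x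
  inv : ∀ x y, T x y → T (sig k x) (sig k y)
  diam : T i (i + k)
  only : ∀ y, T i y → y = i ∨ y = i + k

def InR (k i x : ℕ) : Prop := i < x ∧ x < i + k
def OutR (k i x : ℕ) : Prop := x < 2 * k ∧ (x < i ∨ i + k < x)

def rel (k i : ℕ) (r : ℕ → ℕ → Prop) (x y : ℕ) : Prop :=
  (InR k i x ∧ InR k i y ∧ r x y) ∨ (OutR k i x ∧ OutR k i y ∧ r (sig k x) (sig k y)) ∨
    ((x = i ∨ x = i + k) ∧ (y = i ∨ y = i + k))

theorem sig_out {k i x : ℕ} (hi : i < k) (h : OutR k i x) : InR k i (sig k x) := by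
  unfold OutR InR sig at *; split_ifs <;> omega

theorem sig_in {k i x : ℕ} (hi : i < k) (h : InR k i x) : OutR k i (sig k x) := by
  unfold OutR InR sig at *; split_ifs <;> omega

theorem sig_sig {k x : ℕ} (h : x < 2 * k) : sig k (sig k x) = x := by
  unfold sig; split_ifs <;> omega

theorem cases3 {k i x : ℕ} (h : x < 2 * k) : InR k i x ∨ OutR k i x ∨ (x = i ∨ x = i + k) := by
  unfold OutR InR; omega

theorem in_out {k i x : ℕ} (h : InR k i x) (h' : OutR k i x) : False := by
  unfold OutR InR at *; omega

theorem in_di {k i x : ℕ} (h : InR k i x) (h' : x = i ∨ x = i + k) : False := by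
  unfold InR at *; omega

theorem out_di {k i x : ℕ} (h : OutR k i x) (h' : x = i ∨ x = i + k) : False := by
  unfold OutR at *; omega

theorem rel_nc {k i : ℕ} {r : ℕ → ℕ → Prop} (hi : i < k) (h : IsNC (i+1) (i+k) r)
    (w x y z : ℕ) (hwx : w < x) (hxy : x < y) (hyz : y < z)
    (h1 : rel k i r w y) (h2 : rel k i r x z) : rel k i r w x := by
  obtain ⟨k1, k2, k3, k4, k5⟩ := h
  rcases h1 with ⟨a1, a2, a3⟩ | ⟨a1, a2, a3⟩ | ⟨a1, a2⟩ <;>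
  rcases h2 with ⟨b1, b2, b3⟩ | ⟨b1, b2, b3⟩ | ⟨b1, b2⟩
  · exact Or.inl ⟨a1, b1, k5 _ _ _ _ hwx hxy hyz a3 b3⟩
  · unfold InR OutR at *; omega
  · unfold InR at *; omega
  · unfold InR OutR at *; omega
  · refine Or.inr (Or.inl ⟨a1, b1, ?_⟩)
    have swap : ∀ u, OutR k i u → (u < i ∧ sig k u = u + k) ∨ (i + k < u ∧ sig k u = u - k) := by
      intro u hu; unfold OutR at hu; unfold sig
      split_ifs <;> omega
    have sw := swap w a1
    have sx := swap x b1
    have sy := swap y a2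
    have sz := swap z b2
    unfold OutR at a1 a2 b1 b2
    generalize sig k w = w' at *
    generalize sig k x = x' at *
    generalize sig k y = y' at *
    generalize sig k z = z' at *
    have a3' := k2 _ _ a3
    have b3' := k2 _ _ b3
    rcases sw with ⟨sw, ew⟩ | ⟨sw, ew⟩
    · rcases sx with ⟨sx, ex⟩ | ⟨sx, ex⟩
      · rcases sy with ⟨sy, ey⟩ | ⟨sy, ey⟩
        · rcases sz with ⟨sz, ez⟩ | ⟨sz, ez⟩
          · exact k5 w' x' y' z' (by omega) (by omega) (by omega) a3 b3
          · have := k5 z' w' x' y' (by omega) (by omega) (by omega) b3' a3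
            exact k3 _ _ _ (k2 _ _ this) b3'
        · have := k5 y' z' w' x' (by omega) (by omega) (by omega) a3' b3'
          exact k3 _ _ _ (k3 _ _ _ a3 this) b3'
      · have := k5 x' y' z' w' (by omega) (by omega) (by omega) b3 a3'
        exact k3 _ _ _ a3 (k2 _ _ this)
    · exact k5 w' x' y' z' (by omega) (by omega) (by omega) a3 b3
  · unfold OutR at *; omega
  · unfold InR at *; omega
  · unfold OutR at *; omega
  · omega

theorem rel_isMain {k i : ℕ} {r : ℕ → ℕ → Prop} (hi : i < k) (h : IsNC (i+1) (i+k) r) :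
    IsMain k i (rel k i r) := by
  have hnc := rel_nc hi h
  obtain ⟨k1, k2, k3, k4, k5⟩ := h
  refine ⟨hi, ?_, ?_, ?_, ?_, hnc, ?_, ?_, ?_⟩
  · intro x hx
    rcases cases3 (i := i) hx with h | h | h
    · exact Or.inl ⟨h, h, k1 _⟩
    · exact Or.inr (Or.inl ⟨h, h, k1 _⟩)
    · exact Or.inr (Or.inr ⟨h, h⟩)
  · rintro x y (⟨a1, a2, a3⟩ | ⟨a1, a2, a3⟩ | ⟨a1, a2⟩)
    · exact Or.inl ⟨a2, a1, k2 _ _ a3⟩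
    · exact Or.inr (Or.inl ⟨a2, a1, k2 _ _ a3⟩)
    · exact Or.inr (Or.inr ⟨a2, a1⟩)
  · rintro x y z (⟨a1, a2, a3⟩ | ⟨a1, a2, a3⟩ | ⟨a1, a2⟩) (⟨b1, b2, b3⟩ | ⟨b1, b2, b3⟩ | ⟨b1, b2⟩)
    · exact Or.inl ⟨a1, b2, k3 _ _ _ a3 b3⟩
    · exact (in_out a2 b1).elim
    · exact (in_di a2 b1).elim
    · exact (in_out b1 a2).elim
    · exact Or.inr (Or.inl ⟨a1, b2, k3 _ _ _ a3 b3⟩)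
    · exact (out_di a2 b1).elim
    · exact (in_di b1 a2).elim
    · exact (out_di b1 a2).elim
    · exact Or.inr (Or.inr ⟨a1, b2⟩)
  · rintro x y (⟨a1, a2, a3⟩ | ⟨a1, a2, a3⟩ | ⟨a1, a2⟩)
    · unfold InR at *; omega
    · exact ⟨a1.1, a2.1⟩
    · omega
  · rintro x y (⟨a1, a2, a3⟩ | ⟨a1, a2, a3⟩ | ⟨a1, a2⟩)
    · refine Or.inr (Or.inl ⟨sig_in hi a1, sig_in hi a2, ?_⟩)
      unfold InR at *
      rwa [sig_sig (by omega), sig_sig (by omega)]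
    · exact Or.inl ⟨sig_out hi a1, sig_out hi a2, a3⟩
    · refine Or.inr (Or.inr ⟨?_, ?_⟩) <;> unfold sig <;> split_ifs <;> omega
  · exact Or.inr (Or.inr ⟨Or.inl rfl, Or.inr rfl⟩)
  · rintro y (⟨a1, a2, a3⟩ | ⟨a1, a2, a3⟩ | ⟨a1, a2⟩)
    · exact (in_di a1 (Or.inl rfl)).elim
    · exact (out_di a1 (Or.inl rfl)).elim
    · exact a2

theorem restr_rel {k i : ℕ} {r : ℕ → ℕ → Prop} (h : IsNC (i+1) (i+k) r) :
    restr (i+1) (i+k) (rel k i r) = r := by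
  obtain ⟨k1, k2, k3, k4, k5⟩ := h
  funext x y
  have e := k4 x y
  have e1 := k1 x
  apply propext
  unfold restr rel InR OutR
  constructor
  · rintro (h | ⟨a1, a2, a3, a4, h | h | h⟩)
    · rw [← h]; exact e1
    · exact h.2.2
    · omega
    · omega
  · intro h
    rcases e h with h' | h'
    · exact Or.inl h'
    · exact Or.inr ⟨h'.1, h'.2.1, h'.2.2.1, h'.2.2.2, Or.inl ⟨by omega, by omega, h⟩⟩

theorem main_restr {k i : ℕ} {T : ℕ → ℕ → Prop} (h : IsMain k i T) :
    IsNC (i+1) (i+k) (restr (i+1) (i+k) T) := by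
  obtain ⟨hi, k1, k2, k3, k4, k5, k6, k7, k8⟩ := h
  constructor <;> unfold restr
  · grind
  · grind
  · grind
  · grind
  · intro w x y z _ _ _ h6 h7
    have := k5 w x y z
    grind

theorem rel_restr {k i : ℕ} {T : ℕ → ℕ → Prop} (h : IsMain k i T) :
    rel k i (restr (i+1) (i+k) T) = T := by
  obtain ⟨hi, k1, k2, k3, k4, k5, k6, k7, k8⟩ := h
  have inout : ∀ x y, InR k i x → OutR k i y → ¬ T x y := by
    intro x y hx hy hT
    unfold InR OutR at *
    rcases hy.2 with hy' | hy'
    · have h1 := k5 y i x (i+k) hy' (by omega) (by omega) (k2 _ _ hT) k7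
      have := k8 _ (k2 _ _ h1)
      omega
    · have h1 := k5 i x (i+k) y (by omega) (by omega) (by omega) k7 hT
      have := k8 _ h1
      omega
  have k9 : ∀ y, T (i+k) y → y = i ∨ y = i + k := fun y hy => k8 y (k3 _ _ _ k7 hy)
  have kd : ∀ x y, (x = i ∨ x = i + k) → T x y → (y = i ∨ y = i + k) := by
    rintro x y (rfl | rfl) hT
    · exact k8 _ hT
    · exact k9 _ hT
  have back : ∀ x y, x < 2 * k → y < 2 * k → T (sig k x) (sig k y) → T x y := by
    intro x y hx hy hT
    have := k6 _ _ hT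
    rwa [sig_sig hx, sig_sig hy] at this
  funext x y
  apply propext
  constructor
  · rintro (⟨a1, a2, a3⟩ | ⟨a1, a2, a3⟩ | ⟨a1, a2⟩)
    · rcases a3 with rfl | a3
      · exact k1 _ (by unfold InR at a1; omega)
      · exact a3.2.2.2.2
    · apply back _ _ a1.1 a2.1
      rcases a3 with a3 | a3
      · rw [a3]
        exact k1 _ (by have := sig_out hi a2; unfold InR at this; omega)
      · exact a3.2.2.2.2
    · rcases a1 with rfl | rfl <;> rcases a2 with rfl | rfl
      · exact k1 _ (by omega)
      · exact k7
      · exact k2 _ _ k7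
      · exact k1 _ (by omega)
  · intro hT
    have hs := k4 _ _ hT
    rcases cases3 (i := i) hs.1 with hx | hx | hx <;> rcases cases3 (i := i) hs.2 with hy | hy | hy
    · refine Or.inl ⟨hx, hy, Or.inr ?_⟩
      unfold InR at *
      exact ⟨by omega, by omega, by omega, by omega, hT⟩
    · exact (inout _ _ hx hy hT).elim
    · exact (in_di hx (kd _ _ hy (k2 _ _ hT))).elim
    · exact (inout _ _ hy hx (k2 _ _ hT)).elim
    · refine Or.inr (Or.inl ⟨hx, hy, Or.inr ?_⟩)
      have hx' := sig_out hi hx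
      have hy' := sig_out hi hy
      unfold InR at *
      exact ⟨by omega, by omega, by omega, by omega, k6 _ _ hT⟩
    · exact (out_di hx (kd _ _ hy (k2 _ _ hT))).elim
    · exact (in_di hy (kd _ _ hx hT)).elim
    · exact (out_di hy (kd _ _ hx hT)).elim
    · exact Or.inr (Or.inr ⟨hx, hy⟩)

theorem main_unique {k i j : ℕ} {T : ℕ → ℕ → Prop} (h : IsMain k i T) (h' : IsMain k j T) :
    i = j := by
  have a1 := h.hi
  have a2 := h'.hi
  rcases Nat.lt_trichotomy i j with hlt | heq | hlt
  · have := h.only _ (h.nc i j (i+k) (j+k) hlt (by omega) (by omega) h.diam h'.diam)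
    omega
  · exact heq
  · have := h'.only _ (h.nc j i (j+k) (i+k) hlt (by omega) (by omega) h'.diam h.diam)
    omega

def toPart (k : ℕ) (T : ℕ → ℕ → Prop) : Set (Set (Fin (2*k))) :=
  {B | ∃ y : Fin (2*k), B = {x | T x.val y.val}}

theorem rot_val (k : ℕ) (x : Fin (2*k)) : (rot (2*k) k x).val = sig k x.val := by
  have := x.2
  simp only [rot, sig]
  split_ifs
  · exact Nat.mod_eq_of_lt (by omega)
  · rw [Nat.mod_eq_sub_mod (by omega), Nat.mod_eq_of_lt (by omega)]
    omega

theorem rot_rot (k : ℕ) (x : Fin (2*k)) : rot (2*k) k (rot (2*k) k x) = x := by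
  apply Fin.ext
  rw [rot_val, rot_val, sig_sig x.2]

def Target (k : ℕ) (π : Set (Set (Fin (2*k)))) : Prop :=
  π ∈ NCA (2*k) ∧ RotInv (2*k) k π ∧
        ∃ i : Fin (2*k), i.val < k ∧ ({i, rot (2*k) k i} : Set (Fin (2*k))) ∈ π

theorem toPart_target {k i : ℕ} {T : ℕ → ℕ → Prop} (h : IsMain k i T) : Target k (toPart k T) := by
  obtain ⟨hi, k1, k2, k3, k4, k5, k6, k7, k8⟩ := h
  have blk : ∀ B ∈ toPart k T, ∀ x ∈ B, B = {z : Fin (2*k) | T z.val x.val} := by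
    rintro B ⟨y, rfl⟩ x hx
    ext z
    exact ⟨fun hz => k3 _ _ _ hz (k2 _ _ hx), fun hz => k3 _ _ _ hz hx⟩
  refine ⟨⟨⟨?_, ?_⟩, ?_⟩, ?_, ?_⟩
  · rintro ⟨y, hy⟩
    have : y ∈ (∅ : Set (Fin (2*k))) := by rw [hy]; exact k1 _ y.2
    exact this
  · intro a
    refine ⟨{z | T z.val a.val}, ⟨⟨a, rfl⟩, k1 _ a.2⟩, ?_⟩
    rintro B ⟨hB, ha⟩
    exact blk B hB a ha
  · intro a b c d hab hbc hcd B hB B' hB' hne ha hc hb hd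
    apply hne
    have e1 := blk B hB a ha
    have e2 := blk B' hB' b hb
    rw [e1] at hc
    rw [e2] at hd
    have := k5 a b c d hab hbc hcd (k2 _ _ hc) (k2 _ _ hd)
    have hb' : b ∈ B := by rw [e1]; exact k2 _ _ this
    rw [e2]; exact blk B hB b hb'
  · rintro B ⟨y, rfl⟩
    refine ⟨rot (2*k) k y, ?_⟩
    ext z
    constructor
    · rintro ⟨x, hx, rfl⟩
      show T _ _
      rw [rot_val, rot_val]; exact k6 _ _ hx
    · intro hz
      refine ⟨rot (2*k) k z, ?_, rot_rot k z⟩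
      have := k6 _ _ hz
      rw [rot_val, sig_sig y.2, ← rot_val] at this
      exact this
  · refine ⟨⟨i, by omega⟩, hi, ⟨i, by omega⟩, ?_⟩
    have hs : sig k i = i + k := if_pos hi
    ext z
    simp only [Set.mem_insert_iff, Set.mem_singleton_iff, Set.mem_ofPred_eq, Fin.ext_iff, rot_val, hs]
    constructor
    · rintro (h | h)
      · rw [h]; exact k1 _ (by omega)
      · rw [h]; exact k2 _ _ k7
    · intro h; exact k8 _ (k2 _ _ h)

theorem toPart_le {k i j : ℕ} {T T' : ℕ → ℕ → Prop} (h : IsMain k i T) (h' : IsMain k j T')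
    (e : toPart k T = toPart k T') (x y : ℕ) (hT : T x y) : T' x y := by
  obtain ⟨hx, hy⟩ := h.supp _ _ hT
  have hm : {z : Fin (2*k) | T z.val y} ∈ toPart k T := ⟨⟨y, hy⟩, rfl⟩
  rw [e] at hm
  obtain ⟨w, hw⟩ := hm
  have m1 : (⟨x, hx⟩ : Fin (2*k)) ∈ {z : Fin (2*k) | T' z.val w.val} := by rw [← hw]; exact hT
  have m2 : (⟨y, hy⟩ : Fin (2*k)) ∈ {z : Fin (2*k) | T' z.val w.val} := by
    rw [← hw]; exact h.rfl' _ hy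
  exact h'.trans' _ _ _ m1 (h'.symm' _ _ m2)

theorem toPart_inj {k i j : ℕ} {T T' : ℕ → ℕ → Prop} (h : IsMain k i T) (h' : IsMain k j T')
    (e : toPart k T = toPart k T') : T = T' := by
  funext x y
  exact propext ⟨toPart_le h h' e x y, toPart_le h' h e.symm x y⟩

theorem toPart_surj {k : ℕ} {π : Set (Set (Fin (2*k)))} (h : Target k π) :
    ∃ i T, IsMain k i T ∧ toPart k T = π := by
  obtain ⟨⟨⟨hne, hp⟩, hnc⟩, hrot, i, hi, hB⟩ := h
  have uniq : ∀ B ∈ π, ∀ B' ∈ π, ∀ x, x ∈ B → x ∈ B' → B = B' := by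
    intro B hB B' hB' x hx hx'
    exact (hp x).unique ⟨hB, hx⟩ ⟨hB', hx'⟩
  have hri : (rot (2*k) k i).val = i.val + k := by rw [rot_val]; exact if_pos hi
  refine ⟨i, fun x y => ∃ hx hy, ∃ B ∈ π, (⟨x, hx⟩ : Fin (2*k)) ∈ B ∧ (⟨y, hy⟩ : Fin (2*k)) ∈ B,
    ⟨hi, ?_, ?_, ?_, ?_, ?_, ?_, ?_, ?_⟩, ?_⟩
  · intro x hx
    obtain ⟨B, ⟨h1, h2⟩, _⟩ := hp ⟨x, hx⟩
    exact ⟨hx, hx, B, h1, h2, h2⟩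
  · rintro x y ⟨hx, hy, B, h1, h2, h3⟩
    exact ⟨hy, hx, B, h1, h3, h2⟩
  · rintro x y z ⟨hx, hy, B, h1, h2, h3⟩ ⟨_, hz, B', h1', h2', h3'⟩
    have := uniq B h1 B' h1' _ h3 h2'
    subst this
    exact ⟨hx, hz, B, h1, h2, h3'⟩
  · rintro x y ⟨hx, hy, _⟩
    exact ⟨hx, hy⟩
  · rintro w x y z hwx hxy hyz ⟨hw, hy, B, h1, h2, h3⟩ ⟨hx, hz, B', h1', h2', h3'⟩
    by_cases hBB : B = B'
    · subst hBB
      exact ⟨hw, hx, B, h1, h2, h2'⟩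
    · exact (hnc ⟨w, hw⟩ ⟨x, hx⟩ ⟨y, hy⟩ ⟨z, hz⟩ hwx hxy hyz B h1 B' h1' hBB h2 h3 h2' h3').elim
  · rintro x y ⟨hx, hy, B, h1, h2, h3⟩
    have e : ∀ u (hu : u < 2*k), ∃ hv, rot (2*k) k ⟨u, hu⟩ = ⟨sig k u, hv⟩ := by
      intro u hu
      have := rot_val k ⟨u, hu⟩
      have h2 := (rot (2*k) k ⟨u, hu⟩).2
      rw [this] at h2
      exact ⟨h2, Fin.ext this⟩
    obtain ⟨vx, ex⟩ := e x hx
    obtain ⟨vy, ey⟩ := e y hy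
    exact ⟨vx, vy, _, hrot B h1, ⟨_, h2, ex⟩, ⟨_, h3, ey⟩⟩
  · exact ⟨by omega, by omega, _, hB, Or.inl rfl, Or.inr (Fin.ext hri.symm)⟩
  · rintro y ⟨hx, hy, B, h1, h2, h3⟩
    have := uniq B h1 _ hB i h2 (Or.inl rfl)
    subst this
    rcases h3 with h3 | h3
    · left; exact congrArg Fin.val h3
    · right; rw [← hri]; exact congrArg Fin.val h3
  · have cls : ∀ B ∈ π, ∀ y ∈ B, {x : Fin (2*k) | ∃ (hx : x.val < 2*k) (hy : y.val < 2*k),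
        ∃ B ∈ π, (⟨x.val, hx⟩ : Fin (2*k)) ∈ B ∧ (⟨y.val, hy⟩ : Fin (2*k)) ∈ B} = B := by
      intro B hB y hy
      ext x
      constructor
      · rintro ⟨hx, hy', B', h1, h2, h3⟩
        have := uniq B hB B' h1 y hy h3
        subst this
        exact h2
      · intro hx
        exact ⟨x.2, y.2, B, hB, hx, hy⟩
    ext B
    constructor
    · rintro ⟨y, rfl⟩
      obtain ⟨B, ⟨h1, h2⟩, _⟩ := hp y
      have := cls B h1 y h2
      exact this.symm ▸ h1
    · intro hB
      have hn : B.Nonempty := by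
        rw [Set.nonempty_iff_ne_empty]; rintro rfl; exact hne hB
      obtain ⟨y, hy⟩ := hn
      exact ⟨y, (cls B hB y hy).symm⟩

theorem card_target (k : ℕ) (hk : 1 ≤ k) :
    Nat.card {π // Target k π} = (2 * (k - 1)).choose (k - 1) := by
  let X := Σ i : Fin k, {r // IsNC (i.val+1) (i.val+1+(k-1)) r}
  have key : ∀ i : Fin k, i.val + 1 + (k-1) = i.val + k := by intro i; omega
  let F : X → {π // Target k π} := fun p =>
    ⟨toPart k (rel k p.1 p.2.1), toPart_target (rel_isMain p.1.2 (p.2.2.congr_right (key p.1)))⟩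
  have hF : Function.Bijective F := by
    constructor
    · rintro ⟨i, r, hr⟩ ⟨j, s, hs⟩ heq
      have heq : toPart k (rel k i r) = toPart k (rel k j s) := congrArg Subtype.val heq
      have hr' := hr.congr_right (key i)
      have hs' := hs.congr_right (key j)
      have m1 := rel_isMain i.2 hr'
      have m2 := rel_isMain j.2 hs'
      have e := toPart_inj m1 m2 heq
      have hij : i = j := by
        rw [e] at m1
        exact Fin.ext (main_unique m1 m2)
      subst hij
      have l1 := restr_rel hr'
      have l2 := restr_rel hs'
      rw [e] at l1
      have : r = s := l1.symm.trans l2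
      subst this
      rfl
    · rintro ⟨π, hπ⟩
      obtain ⟨i, T, hT, rfl⟩ := toPart_surj hπ
      refine ⟨⟨⟨i, hT.hi⟩, restr (i+1) (i+k) T,
        (main_restr hT).congr_right (key ⟨i, hT.hi⟩).symm⟩, ?_⟩
      apply Subtype.ext
      show toPart k (rel k i (restr (i+1) (i+k) T)) = _
      rw [rel_restr hT]
  have fin1 : ∀ i : Fin k, Finite {r // IsNC (i.val+1) (i.val+1+(k-1)) r} :=
    fun i => (card_NC (k-1) (i.val+1)).1
  rw [← Nat.card_congr (Equiv.ofBijective F hF), Nat.card_sigma,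
    Finset.sum_congr rfl (fun (i : Fin k) _ => (card_NC (k-1) (i.val+1)).2)]
  have := succ_mul_catalan_eq_centralBinom (k-1)
  rw [Nat.sub_add_cancel hk, Nat.centralBinom_eq_two_mul_choose] at this
  simpa using this

/-- Let `k ≥ 2` and `m = 2k`. The number of elements of `NC^A(m)` invariant under `ρ_k`
which contain a block of the form `{i, i+k}` with `0 ≤ i ≤ k-1` equals `C(2(k-1), k-1)`. -/
theorem number_of_invariant_partitions_with_antipodal_pair_block
    (k m : ℕ) (hk : 2 ≤ k) (hm : m = 2 * k) :
    Nat.card {π : Set (Set (Fin m)) // π ∈ NCA m ∧ RotInv m k π ∧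
        ∃ i : Fin m, i.val < k ∧ ({i, rot m k i} : Set (Fin m)) ∈ π} =
      (2 * (k - 1)).choose (k - 1) := by
  subst hm
  exact card_target k (by omega)
end

section
/- Let T be a pretriangulated category with suspension functor Σ, let S be a thick subcategory of T, let τ be an exact autoequivalence of T, and let h ≥ 1 be an integer such that there is a natural isomorphism τ^h ≅ Σ². Then for every integer p ≥ 1, setting s = gcd(h, p), the subcategory S is stable under τ^p if and only if S is stable under τ^s. -/
open CategoryTheory CategoryTheory.Limits CategoryTheory.Pretriangulated

universe v u

variable (T : Type u) [Category.{v} T] [HasShift T ℤ] [HasZeroObject T] [Preadditive T]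
  [∀ n : ℤ, (CategoryTheory.shiftFunctor T n).Additive] [Pretriangulated T]

/-- A thick subcategory of a pretriangulated category: a class of objects closed under
isomorphisms, under the suspension `Σ` and its inverse `Σ⁻¹`, satisfying the two-out-of-three
property for distinguished triangles, and closed under direct summands. -/
structure IsThickSubcategory (S : Set T) : Prop where
  iso_closed : ∀ ⦃X Y : T⦄, Nonempty (X ≅ Y) → X ∈ S → Y ∈ S
  shift_closed : ∀ X ∈ S, (CategoryTheory.shiftFunctor T (1 : ℤ)).obj X ∈ S
  unshift_closed : ∀ X ∈ S, (CategoryTheory.shiftFunctor T (-1 : ℤ)).obj X ∈ S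
  two_of_three : ∀ Tr : Triangle T, (Tr ∈ distTriang T) →
    (Tr.obj₁ ∈ S → Tr.obj₂ ∈ S → Tr.obj₃ ∈ S) ∧
    (Tr.obj₁ ∈ S → Tr.obj₃ ∈ S → Tr.obj₂ ∈ S) ∧
    (Tr.obj₂ ∈ S → Tr.obj₃ ∈ S → Tr.obj₁ ∈ S)
  summand_closed : ∀ X Z : T, Z ∈ S → (∃ (i : X ⟶ Z) (r : Z ⟶ X), i ≫ r = 𝟙 X) → X ∈ S

/-- The `n`-th power (iterated composition) of an endofunctor. -/
def fpow {C : Type u} [Category.{v} C] (F : C ⥤ C) : ℕ → (C ⥤ C)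
  | 0 => 𝟭 C
  | n + 1 => fpow F n ⋙ F

/-- A subcategory `S` is stable under an endofunctor `G` if `G X ∈ S` for all `X ∈ S`. -/
def StableUnder {C : Type u} [Category.{v} C] (S : Set C) (G : C ⥤ C) : Prop :=
  ∀ X ∈ S, G.obj X ∈ S

theorem fpow_obj_add {C : Type u} [Category.{v} C] (F : C ⥤ C) (m n : ℕ) (X : C) :
    (fpow F (m + n)).obj X = (fpow F m).obj ((fpow F n).obj X) := by
  induction m with
  | zero => simp [fpow]
  | succ k ih =>
    rw [Nat.add_right_comm]
    change F.obj _ = F.obj _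
    rw [ih]

theorem stable_fpow_mul {C : Type u} [Category.{v} C] (S : Set C) (F : C ⥤ C) (p : ℕ)
    (hF : StableUnder S (fpow F p)) (a : ℕ) : StableUnder S (fpow F (p * a)) := by
  induction a with
  | zero => exact fun X hX => hX
  | succ k ih =>
    intro X hX
    rw [Nat.mul_succ, fpow_obj_add]
    exact ih _ (hF X hX)

theorem reflect_fpow_mul {C : Type u} [Category.{v} C] (S : Set C) (F : C ⥤ C) (p : ℕ)
    (hF : ∀ X, (fpow F p).obj X ∈ S → X ∈ S) (a : ℕ) :
    ∀ X, (fpow F (p * a)).obj X ∈ S → X ∈ S := by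
  induction a with
  | zero => exact fun X hX => hX
  | succ k ih =>
    intro X hX
    rw [Nat.mul_succ, fpow_obj_add] at hX
    exact hF _ (ih _ hX)

/-- Let `T` be a pretriangulated category, `S` a thick subcategory, `τ` an exact
autoequivalence of `T`, and `h ≥ 1` with a natural isomorphism `τ^h ≅ Σ²`. Then for every
`p ≥ 1`, with `s = gcd(h, p)`, `S` is stable under `τ^p` iff `S` is stable under `τ^s`. -/
theorem stable_under_power_iff_stable_under_gcd
    (S : Set T) (hS : IsThickSubcategory T S)
    (τ : T ⥤ T) [τ.IsEquivalence] [τ.CommShift ℤ] [τ.IsTriangulated]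
    (h : ℕ) (hh : 1 ≤ h)
    (hiso : Nonempty (fpow τ h ≅ CategoryTheory.shiftFunctor T (2 : ℤ)))
    (p : ℕ) (hp : 1 ≤ p) :
    StableUnder S (fpow τ p) ↔ StableUnder S (fpow τ (Nat.gcd h p)) := by
  obtain ⟨e⟩ := hiso
  have hst : StableUnder S (fpow τ h) := fun X hX =>
    hS.iso_closed ⟨((shiftFunctorAdd' T (1 : ℤ) 1 2 (by norm_num)).app X).symm ≪≫ (e.app X).symm⟩
      (hS.shift_closed _ (hS.shift_closed _ hX))
  have hre : ∀ X, (fpow τ h).obj X ∈ S → X ∈ S := fun X hX => by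
    have h2 : (shiftFunctor T (2 : ℤ)).obj X ∈ S := hS.iso_closed ⟨e.app X⟩ hX
    have h1 : (shiftFunctor T (1 : ℤ)).obj X ∈ S :=
      hS.iso_closed ⟨((shiftFunctorAdd' T (2 : ℤ) (-1) 1 (by norm_num)).app X).symm⟩
        (hS.unshift_closed _ h2)
    exact hS.iso_closed ⟨(shiftFunctorCompIsoId T (1 : ℤ) (-1) (by norm_num)).app X⟩
        (hS.unshift_closed _ h1)
  constructor
  · intro H
    rcases (Nat.gcd_le_left p hh).lt_or_eq with hlt | heq
    · rw [Nat.gcd_comm] at hlt ⊢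
      obtain ⟨m, _, hm⟩ := Nat.exists_mul_mod_eq_gcd hlt
      intro X hX
      have h1 := stable_fpow_mul S τ p H m X hX
      rw [← Nat.div_add_mod (p * m) h, hm, fpow_obj_add] at h1
      exact reflect_fpow_mul S τ h hre _ _ h1
    · rw [heq]
      exact hst
  · intro H
    obtain ⟨k, hk⟩ := Nat.gcd_dvd_right h p
    have h1 := stable_fpow_mul S τ _ H k
    rwa [← hk] at h1
end
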